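/- Let m be an even positive integer, H̃ ∈ Ω_{4n} an invertible Hermitian complex matrix, and B̃ ∈ Ω_{4n} an H̃-selfadjoint matrix whose spectrum consists only of negative real numbers. Then there exists an H̃-selfadjoint matrix Ã ∈ Ω_{4n} with Ã^m = B̃ if and only if there exist a positive integer t, sizes k_1,…,k_t, negative real numbers λ_1,…,λ_t, and an invertible matrix S ∈ Ω_{4n} such that S⁻¹B̃S = [⊕_{j=1}^{t} (J_{k_j}(λ_j) ⊕ J_{k_j}(λ_j))] ⊕ [⊕_{j=1}^{t} (J_{k_j}(λ_j) ⊕ J_{k_j}(λ_j))] and S*H̃S = [⊕_{j=1}^{t} (Q_{k_j} ⊕ −Q_{k_j})] ⊕ [⊕_{j=1}^{t} (Q_{k_j} ⊕ −Q_{k_j})]. -/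

import Mathlib

open Matrix

noncomputable section

/-- The `k×k` upper-triangular Jordan block with eigenvalue `lam`. -/
def jordanBlock {R : Type*} [Zero R] [One R] (lam : R) (k : ℕ) : Matrix (Fin k) (Fin k) R :=
  Matrix.of fun i j => if (i : ℕ) = (j : ℕ) then lam else if (i : ℕ) + 1 = (j : ℕ) then 1 else 0

/-- The `k×k` sip matrix: ones on the main anti-diagonal, zeros elsewhere. -/
def sip (R : Type*) [Zero R] [One R] (k : ℕ) : Matrix (Fin k) (Fin k) R :=
  Matrix.of fun i j => if (i : ℕ) + (j : ℕ) = k - 1 then 1 else 0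

/-- The order-preserving identification of `Fin k ⊕ Fin k` with `Fin (2*k)`. -/
def finTwoMul (k : ℕ) : (Fin k ⊕ Fin k) ≃ Fin (2 * k) :=
  finSumFinEquiv.trans (finCongr (two_mul k).symm)

/-- Block-diagonal direct sum `M ⊕ N` of two `k×k` matrices, as a `(2k)×(2k)` matrix. -/
def dsum2 {R : Type*} [Zero R] {k : ℕ} (M N : Matrix (Fin k) (Fin k) R) :
    Matrix (Fin (2 * k)) (Fin (2 * k)) R :=
  Matrix.reindex (finTwoMul k) (finTwoMul k) (Matrix.fromBlocks M 0 0 N)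

/-- The `2n×2n` complex matrix `[[A₁, conj A₂], [−A₂, conj A₁]]`. -/
def omegaMap {n : ℕ} (A₁ A₂ : Matrix (Fin n) (Fin n) ℂ) :
    Matrix (Fin (2 * n)) (Fin (2 * n)) ℂ :=
  Matrix.reindex (finTwoMul n) (finTwoMul n)
    (Matrix.fromBlocks A₁ (A₂.map (starRingEnd ℂ)) (-A₂) (A₁.map (starRingEnd ℂ)))

/-- Membership in the real subalgebra `Ω_{2n}` of `2n×2n` complex matrices. -/
def InOmega {n : ℕ} (M : Matrix (Fin (2 * n)) (Fin (2 * n)) ℂ) : Prop :=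
  ∃ A₁ A₂ : Matrix (Fin n) (Fin n) ℂ, M = omegaMap A₁ A₂


section SymplecticJordan

open Polynomial

variable {K V : Type*} [Field K] [AddCommGroup V] [Module K V]

theorem bilin_aeval_comm {b : LinearMap.BilinForm K V} {B : Module.End K V}
    (hB : ∀ x y, b (B x) y = b x (B y)) (p : K[X]) (x y : V) :
    b (aeval B p x) y = b x (aeval B p y) := by
  have hpow : ∀ (s : ℕ) (x y : V), b ((B ^ s) x) y = b x ((B ^ s) y) := by
    intro s
    induction s with
    | zero => simp
    | succ s ih =>
      intro x y
      rw [pow_succ', Module.End.mul_apply, hB, ih, ← Module.End.mul_apply, ← pow_succ, pow_succ']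
  induction p using Polynomial.induction_on' with
  | add p q hp hq => simp [hp, hq]
  | monomial s a => simp [aeval_monomial, hpow, Algebra.algebraMap_eq_smul_one]

theorem bilin_self_aeval_eq_zero [CharZero K] {b : LinearMap.BilinForm K V} {B : Module.End K V}
    (hb : b.IsAlt) (hB : ∀ x y, b (B x) y = b x (B y)) (p : K[X]) (x : V) :
    b x (aeval B p x) = 0 := by
  have h := hb.neg_eq x (aeval B p x)
  rw [bilin_aeval_comm hB] at h
  exact self_eq_neg.mp h.symm

/-- A truncated power-series inverse. -/
theorem exists_convolution_inverse (c : ℕ → K) (hc : c 0 ≠ 0) :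
    ∃ a : ℕ → K, ∀ n, ∑ i ∈ Finset.range (n + 1), a i * c (n - i) = if n = 0 then 1 else 0 := by
  refine ⟨fun i => PowerSeries.coeff i (PowerSeries.mk c)⁻¹, fun n => ?_⟩
  have h : (PowerSeries.mk c)⁻¹ * PowerSeries.mk c = 1 :=
    PowerSeries.inv_mul_cancel _ (by simpa using hc)
  have h2 := congrArg (PowerSeries.coeff n) h
  rw [PowerSeries.coeff_mul, PowerSeries.coeff_one,
    Finset.Nat.sum_antidiagonal_eq_sum_range_succ_mk] at h2
  simpa using h2

theorem exists_max_jordan_pair [IsAlgClosed K] [FiniteDimensional K V] [Nontrivial V]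
    {b : LinearMap.BilinForm K V} {B : Module.End K V}
    (hnd : b.Nondegenerate) (hB : ∀ x y, b (B x) y = b x (B y)) :
    ∃ (l : K) (k : ℕ) (x y : V), B.HasEigenvalue l ∧ 0 < k ∧
      aeval B ((X - C l) ^ k) x = 0 ∧ aeval B ((X - C l) ^ k) y = 0 ∧
      b x (aeval B ((X - C l) ^ (k - 1)) y) ≠ 0 := by
  obtain ⟨l, hl⟩ := Module.End.exists_eigenvalue B
  have hm0 : minpoly K B ≠ 0 := minpoly.ne_zero (Algebra.IsIntegral.isIntegral B)
  obtain ⟨r, hr, hndvd⟩ := exists_eq_pow_rootMultiplicity_mul_and_not_dvd _ hm0 l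
  have hroot : (minpoly K B).IsRoot l := Module.End.isRoot_of_hasEigenvalue hl
  have hk : 0 < (minpoly K B).rootMultiplicity l := (rootMultiplicity_pos hm0).mpr hroot
  set k := (minpoly K B).rootMultiplicity l with hkdef
  have hcop : IsCoprime r ((X - C l) ^ k) := by
    refine IsCoprime.pow_right ?_
    exact (((irreducible_X_sub_C l).coprime_iff_not_dvd).mpr hndvd).symm
  obtain ⟨u, v, huv⟩ := hcop
  have hne : aeval B ((X - C l) ^ (k - 1) * r) ≠ 0 := by
    intro h0
    have hdvd := minpoly.dvd K B h0
    rw [hr] at hdvd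
    have hr0 : r ≠ 0 := by rintro rfl; simp at hndvd
    have := (mul_dvd_mul_iff_right hr0).mp hdvd
    have := (pow_dvd_pow_iff (X_sub_C_ne_zero l) (not_isUnit_X_sub_C l)).mp this
    omega
  have hzero : aeval B ((X - C l) ^ k * r) = 0 := by rw [← hr]; exact minpoly.aeval K B
  obtain ⟨z, hz⟩ : ∃ z, aeval B ((X - C l) ^ (k - 1) * r) z ≠ 0 := by
    by_contra! h
    exact hne (LinearMap.ext h)
  obtain ⟨z', hz'⟩ : ∃ z', b (aeval B ((X - C l) ^ (k - 1) * r) z) z' ≠ 0 := by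
    by_contra! h
    exact hz (hnd.1 _ h)
  refine ⟨l, k, aeval B r z, aeval B (u * r) z', hl, hk, ?_, ?_, ?_⟩
  · rw [← Module.End.mul_apply, ← map_mul, hzero]; rfl
  · rw [← Module.End.mul_apply, ← map_mul, mul_left_comm, map_mul, hzero]; simp
  · have e1 : (X - C l) ^ (k - 1) * r = (X - C l) ^ (k - 1) * r * u * r +
        v * (X - C l) ^ (k - 1) * ((X - C l) ^ k * r) := by
      linear_combination (-(X - C l) ^ (k - 1) * r) * huv
    have e2 : aeval B ((X - C l) ^ (k - 1) * r) z =
        aeval B ((X - C l) ^ (k - 1) * (u * r)) (aeval B r z) := by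
      rw [← Module.End.mul_apply, ← map_mul]
      conv_lhs => rw [e1, map_add, map_mul _ (v * _), hzero, mul_zero, add_zero]
      ring_nf
    rwa [← Module.End.mul_apply, ← map_mul, ← bilin_aeval_comm hB, ← e2]

theorem exists_normalized_jordan_pair [IsAlgClosed K] [FiniteDimensional K V] [Nontrivial V]
    {b : LinearMap.BilinForm K V} {B : Module.End K V}
    (hnd : b.Nondegenerate) (hB : ∀ x y, b (B x) y = b x (B y)) :
    ∃ (l : K) (k : ℕ) (x y : V), B.HasEigenvalue l ∧ 0 < k ∧
      aeval B ((X - C l) ^ k) x = 0 ∧ aeval B ((X - C l) ^ k) y = 0 ∧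
      ∀ s, b x (aeval B ((X - C l) ^ s) y) = if s + 1 = k then 1 else 0 := by
  obtain ⟨l, k, x, y, hl, hk, hx, hy, hxy⟩ := exists_max_jordan_pair hnd hB
  obtain ⟨a, ha⟩ := exists_convolution_inverse
    (fun i => b x (aeval B ((X - C l) ^ (k - 1 - i)) y)) hxy
  have hvan : ∀ s, k ≤ s → aeval B ((X - C l) ^ s) y = 0 := by
    intro s hs
    obtain ⟨d, rfl⟩ := Nat.exists_eq_add_of_le' hs
    rw [pow_add, map_mul, Module.End.mul_apply, hy, map_zero]
  refine ⟨l, k, x, aeval B (∑ i ∈ Finset.range k, C (a i) * (X - C l) ^ i) y, hl, hk, hx, ?_, ?_⟩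
  · rw [← Module.End.mul_apply, ← map_mul, mul_comm, map_mul, Module.End.mul_apply, hy, map_zero]
  · intro s
    rw [← Module.End.mul_apply, ← map_mul, Finset.mul_sum, map_sum, LinearMap.sum_apply, map_sum]
    have hterm : ∀ i, b x (aeval B ((X - C l) ^ s * (C (a i) * (X - C l) ^ i)) y) =
        a i * b x (aeval B ((X - C l) ^ (s + i)) y) := by
      intro i
      rw [mul_left_comm, ← pow_add, map_mul, Module.End.mul_apply, aeval_C,
        Module.algebraMap_end_apply, map_smul, smul_eq_mul]
    simp_rw [hterm]
    by_cases hs : k ≤ s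
    · rw [if_neg (by omega)]
      refine Finset.sum_eq_zero fun i _ => ?_
      rw [hvan _ (by omega)]; simp
    · have h2 := ha (k - 1 - s)
      rw [← Finset.sum_subset (s₁ := Finset.range (k - 1 - s + 1))
        (Finset.range_subset_range.mpr (by omega))]
      · rw [show (if s + 1 = k then (1 : K) else 0) = if k - 1 - s = 0 then 1 else 0 by
          congr 1; simp; omega, ← h2]
        refine Finset.sum_congr rfl fun i hi => ?_
        rw [Finset.mem_range] at hi
        rw [show k - 1 - (k - 1 - s - i) = s + i by omega]
      · intro i _ hi
        rw [Finset.mem_range] at hi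
        rw [hvan _ (by omega)]; simp

theorem bilin_aeval_eq_zero_of_pow {b : LinearMap.BilinForm K V} {B : Module.End K V}
    (hB : ∀ x y, b (B x) y = b x (B y)) {l : K} {k : ℕ} {x w : V}
    (hx : aeval B ((X - C l) ^ k) x = 0)
    (h : ∀ i < k, b (aeval B ((X - C l) ^ i) x) w = 0) (p : K[X]) :
    b x (aeval B p w) = 0 := by
  have h' : ∀ i, b (aeval B ((X - C l) ^ i) x) w = 0 := by
    intro i
    rcases lt_or_ge i k with hi | hi
    · exact h i hi
    · obtain ⟨d, rfl⟩ := Nat.exists_eq_add_of_le' hi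
      rw [pow_add, map_mul, Module.End.mul_apply, hx, map_zero]; simp
  rw [← sum_taylor_eq p l, Polynomial.sum, map_sum, LinearMap.sum_apply, map_sum]
  refine Finset.sum_eq_zero fun i _ => ?_
  rw [map_mul, Module.End.mul_apply, aeval_C, Module.algebraMap_end_apply, map_smul,
    ← bilin_aeval_comm hB, h', smul_zero]

theorem exists_jordan_pair_complement [CharZero K] [FiniteDimensional K V]
    {b : LinearMap.BilinForm K V} {B : Module.End K V} (hb : b.IsAlt)
    (hnd : b.Nondegenerate) (hB : ∀ x y, b (B x) y = b x (B y)) {l : K} {k : ℕ} {x y : V}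
    (hx : aeval B ((X - C l) ^ k) x = 0) (hy : aeval B ((X - C l) ^ k) y = 0)
    (hxy : ∀ s, b x (aeval B ((X - C l) ^ s) y) = if s + 1 = k then 1 else 0) :
    ∃ W : Submodule K V, (∀ w ∈ W, B w ∈ W) ∧ (b.restrict W).Nondegenerate ∧
      Module.finrank K W + 2 * k = Module.finrank K V ∧
      (∀ w ∈ W, ∀ p : K[X], b x (aeval B p w) = 0) ∧
        ∀ w ∈ W, ∀ p : K[X], b y (aeval B p w) = 0 := by
  let N : ℕ → V → V := fun i => aeval B ((X - C l) ^ i)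
  let fam : Fin k ⊕ Fin k → V := Sum.elim (fun i => N i x) (fun i => N i y)
  let fam' : Fin k ⊕ Fin k → V := Sum.elim (fun i => N (k - 1 - i) y) (fun i => - N (k - 1 - i) x)
  have hN : ∀ i j u v, b (N i u) (N j v) = b u (aeval B ((X - C l) ^ (i + j)) v) := by
    intro i j u v
    rw [bilin_aeval_comm hB, ← Module.End.mul_apply, ← map_mul, pow_add]
  have hyx : ∀ s, b y (aeval B ((X - C l) ^ s) x) = if s + 1 = k then -1 else 0 := by
    intro s
    rw [← bilin_aeval_comm hB, ← hb.neg_eq, hxy]; split_ifs <;> simp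
  have hdual : ∀ i j, b (fam i) (fam' j) = if i = j then 1 else 0 := by
    rintro (i | i) (j | j)
    · simp only [fam, fam', Sum.elim_inl, hN, hxy, Sum.inl.injEq, Fin.ext_iff]
      congr 1; simp; omega
    · simp only [fam, fam', Sum.elim_inl, Sum.elim_inr, map_neg, hN, bilin_self_aeval_eq_zero hb hB]
      simp
    · simp only [fam, fam', Sum.elim_inl, Sum.elim_inr, hN, bilin_self_aeval_eq_zero hb hB]
      simp
    · simp only [fam, fam', Sum.elim_inr, map_neg, hN, hyx, Sum.inr.injEq, Fin.ext_iff]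
      have : ((i : ℕ) + (k - 1 - j) + 1 = k) ↔ ((i : ℕ) = j) := by omega
      simp only [this]; split_ifs <;> simp
  have hcoef : ∀ (g : Fin k ⊕ Fin k → K) j, b (∑ i, g i • fam i) (fam' j) = g j := by
    intro g j
    simp only [map_sum, map_smul, LinearMap.sum_apply, LinearMap.smul_apply, hdual, smul_eq_mul,
      mul_ite, mul_one, mul_zero, Finset.sum_ite_eq', Finset.mem_univ, if_true]
  have hli : LinearIndependent K fam := by
    rw [Fintype.linearIndependent_iff]
    intro g hg j
    rw [← hcoef g j, hg]; simp
  set U := Submodule.span K (Set.range fam) with hU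
  have hmem' : ∀ j, fam' j ∈ U := by
    rintro (j | j)
    · exact Submodule.subset_span ⟨Sum.inr ⟨k - 1 - j, by omega⟩, rfl⟩
    · exact Submodule.neg_mem _ (Submodule.subset_span ⟨Sum.inl ⟨k - 1 - j, by omega⟩, rfl⟩)
  have hfr : Module.finrank K U = 2 * k := by
    rw [finrank_span_eq_card hli]; simp; omega
  have hrefl : b.IsRefl := hb.isRefl
  have hdisj : Disjoint U (b.orthogonal U) := by
    rw [Submodule.disjoint_def]
    intro u hu huo
    obtain ⟨g, rfl⟩ := (Submodule.mem_span_range_iff_exists_fun K).mp hu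
    have : g = 0 := by
      funext j
      rw [← hcoef g j]
      exact hrefl _ _ (huo _ (hmem' j))
    simp [this]
  have hfamW : ∀ w ∈ b.orthogonal U, ∀ i, b (fam i) w = 0 := fun w hw i =>
    hw _ (Submodule.subset_span ⟨i, rfl⟩)
  have h1 : ∀ w ∈ b.orthogonal U, ∀ p : K[X], b x (aeval B p w) = 0 := fun w hw =>
    bilin_aeval_eq_zero_of_pow hB hx fun i hi => hfamW w hw (Sum.inl ⟨i, hi⟩)
  have h2 : ∀ w ∈ b.orthogonal U, ∀ p : K[X], b y (aeval B p w) = 0 := fun w hw =>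
    bilin_aeval_eq_zero_of_pow hB hy fun i hi => hfamW w hw (Sum.inr ⟨i, hi⟩)
  refine ⟨b.orthogonal U, ?_, ?_, ?_, h1, h2⟩
  · intro w hw u hu
    have hspan : U ≤ LinearMap.ker (b.flip (B w)) := by
      rw [hU, Submodule.span_le]
      rintro _ ⟨i, rfl⟩
      have hBw : ∀ p : K[X], aeval B p (B w) = aeval B (p * X) w := by
        intro p; rw [map_mul, aeval_X]; rfl
      rcases i with i | i
      · simp only [fam, N, Sum.elim_inl, SetLike.mem_coe, LinearMap.mem_ker,
          LinearMap.BilinForm.flip_apply]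
        rw [bilin_aeval_comm hB, hBw, h1 w hw]
      · simp only [fam, N, Sum.elim_inr, SetLike.mem_coe, LinearMap.mem_ker,
          LinearMap.BilinForm.flip_apply]
        rw [bilin_aeval_comm hB, hBw, h2 w hw]
    exact hspan hu
  · refine b.nondegenerate_restrict_of_disjoint_orthogonal hrefl ?_
    rw [LinearMap.BilinForm.orthogonal_orthogonal hnd hrefl]
    exact hdisj.symm
  · have := Submodule.finrank_le U
    rw [LinearMap.BilinForm.finrank_orthogonal hnd, hfr]
    omega

/-- Symplectic Jordan form: `V` is an orthogonal direct sum of pairs of dually paired cyclic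
spaces generated by `x j` and `y j`. -/
theorem exists_symplectic_jordan {K : Type*} [Field K] [CharZero K] [IsAlgClosed K]
    (P : K → Prop) {l₀ : K} (h₀ : P l₀) (d : ℕ) :
    ∀ {V : Type*} [AddCommGroup V] [Module K V] [FiniteDimensional K V]
    {b : LinearMap.BilinForm K V} {B : Module.End K V}, Module.finrank K V = d → b.IsAlt →
    b.Nondegenerate → (∀ x y, b (B x) y = b x (B y)) → (∀ l, B.HasEigenvalue l → P l) →
    ∃ (ι : Type) (_ : Fintype ι) (_ : Nonempty ι) (k : ι → ℕ) (l : ι → K) (x y : ι → V),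
      (∀ j, P (l j)) ∧
      (∀ j, aeval B ((X - C (l j)) ^ k j) (x j) = 0) ∧
      (∀ j, aeval B ((X - C (l j)) ^ k j) (y j) = 0) ∧
      (∀ i j (p : K[X]), b (x i) (aeval B p (x j)) = 0) ∧
      (∀ i j (p : K[X]), b (y i) (aeval B p (y j)) = 0) ∧
      (∀ i j (p : K[X]), i ≠ j → b (x i) (aeval B p (y j)) = 0) ∧
      (∀ j s, b (x j) (aeval B ((X - C (l j)) ^ s) (y j)) = if s + 1 = k j then 1 else 0) ∧
      ∑ j, 2 * k j = Module.finrank K V := by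
  induction d using Nat.strong_induction_on with
  | _ d ih =>
  intro V _ _ _ b B hd hb hnd hB hP
  rcases subsingleton_or_nontrivial V with hV | hV
  · refine ⟨Unit, inferInstance, inferInstance, fun _ => 0, fun _ => l₀, fun _ => 0, fun _ => 0,
      fun _ => h₀, by simp, by simp, by simp, by simp, by simp, by simp, ?_⟩
    simp [Module.finrank_zero_of_subsingleton]
  obtain ⟨l, k, x, y, hl, hk, hx, hy, hxy⟩ := exists_normalized_jordan_pair hnd hB
  obtain ⟨W, hWB, hWnd, hWfr, hWx, hWy⟩ := exists_jordan_pair_complement hb hnd hB hx hy hxy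
  have hrestr : ∀ (p : K[X]) (w : W), ((aeval (B.restrict hWB) p w : W) : V) = aeval B p w := by
    intro p w
    induction p using Polynomial.induction_on' with
    | add p q hp hq => simp [hp, hq]
    | monomial s a =>
      have : ∀ w : W, (((B.restrict hWB) ^ s) w : V) = (B ^ s) w := by
        intro w
        rw [Module.End.pow_restrict s]; rfl
      simp [aeval_monomial, this]
  have hWP : ∀ l, Module.End.HasEigenvalue (B.restrict hWB) l → P l := by
    intro l hl
    obtain ⟨v, hv⟩ := hl.exists_hasEigenvector
    refine hP l (Module.End.hasEigenvalue_of_hasEigenvector (x := (v : V)) ?_)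
    refine Module.End.hasEigenvector_iff.mpr ⟨?_, by simpa using hv.2⟩
    rw [Module.End.mem_eigenspace_iff]
    exact congrArg Subtype.val hv.apply_eq_smul
  obtain ⟨ι, _, _, k', l', x', y', h0, h1, h2, h3, h4, h5, h6, h7⟩ := ih (Module.finrank K W)
    (by omega) (b := b.restrict W) (B := B.restrict hWB) rfl (fun w => hb w) hWnd
    (fun u v => hB u v) hWP
  have hres : ∀ (u v : W), (b.restrict W) u v = b u v := fun _ _ => rfl
  simp only [hres, hrestr] at h3 h4 h5 h6
  have hxW : ∀ (p : K[X]) (w : W), b w (aeval B p x) = 0 := by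
    intro p w
    rw [← bilin_aeval_comm hB, ← hb.neg_eq, hWx _ w.2, neg_zero]
  have hyW : ∀ (p : K[X]) (w : W), b w (aeval B p y) = 0 := by
    intro p w
    rw [← bilin_aeval_comm hB, ← hb.neg_eq, hWy _ w.2, neg_zero]
  refine ⟨Option ι, inferInstance, inferInstance, fun j => j.elim k k', fun j => j.elim l l',
    fun j => j.elim x (fun i => x' i), fun j => j.elim y (fun i => y' i),
    ?_, ?_, ?_, ?_, ?_, ?_, ?_, ?_⟩
  · rintro (_ | j)
    exacts [hP l hl, h0 j]
  · rintro (_ | j)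
    exacts [hx, (hrestr _ _).symm.trans (congrArg Subtype.val (h1 j))]
  · rintro (_ | j)
    exacts [hy, (hrestr _ _).symm.trans (congrArg Subtype.val (h2 j))]
  · rintro (_ | i) (_ | j) p
    exacts [bilin_self_aeval_eq_zero hb hB p x, hWx _ (x' j).2 p, hxW p _, h3 i j p]
  · rintro (_ | i) (_ | j) p
    exacts [bilin_self_aeval_eq_zero hb hB p y, hWy _ (y' j).2 p, hyW p _, h4 i j p]
  · rintro (_ | i) (_ | j) p hij
    exacts [absurd rfl hij, hWx _ (y' j).2 p, hyW p _, h5 i j p (fun h => hij (by rw [h]))]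
  · rintro (_ | j) s
    exacts [hxy s, h6 j s]
  · rw [Fintype.sum_option]
    simp only [Option.elim]
    omega

end SymplecticJordan

section RealRoot

open Polynomial

theorem exists_pow_root_mod {f : ℝ[X]} {s : Multiset ℝ} (hf : f = (s.map fun a => X - C a).prod)
    (hs : ∀ a ∈ s, 0 < a) {m : ℕ} (hm : 0 < m) :
    ∃ q q' : ℝ[X], f ∣ q ^ m - X ∧ f ∣ q * q' - 1 := by
  classical
  let q₀ := Lagrange.interpolate s.toFinset id fun a => a ^ (1 / m : ℝ)
  have hq₀ : ∀ a ∈ s, q₀.eval a = a ^ (1 / m : ℝ) := fun a ha =>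
    Lagrange.eval_interpolate_at_node (v := id) _ Function.injective_id.injOn
      (Multiset.mem_toFinset.mpr ha)
  have hdvd : f ∣ (q₀ ^ m - X) ^ Multiset.card s := by
    rw [hf, ← Multiset.prod_replicate, ← Multiset.map_const']
    refine Multiset.prod_dvd_prod_of_dvd _ _ fun a ha => ?_
    rw [dvd_iff_isRoot]
    simp only [IsRoot, eval_sub, eval_pow, eval_X, hq₀ a ha, one_div]
    rw [Real.rpow_inv_natCast_pow (hs a ha).le hm.ne', sub_self]
  set x : AdjoinRoot f := AdjoinRoot.mk f X with hxdef
  let P : (AdjoinRoot f)[X] := X ^ m - C x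
  have hP : ∀ z : AdjoinRoot f, aeval z P = z ^ m - x := fun z => by
    rw [coe_aeval_eq_eval]; simp [P]
  have hX : IsUnit x := by
    have hcop : IsCoprime f X := by
      rw [hf]
      refine Multiset.prod_induction (fun p => IsCoprime p (X : ℝ[X])) _
        (fun a b => IsCoprime.mul_left)
        isCoprime_one_left ?_
      intro p hp
      obtain ⟨a, ha, rfl⟩ := Multiset.mem_map.mp hp
      refine ⟨C (-a⁻¹), C a⁻¹, ?_⟩
      have : C a * C a⁻¹ = (1 : ℝ[X]) := by
        rw [← C_mul, mul_inv_cancel₀ (hs a ha).ne', C_1]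
      simp only [C_neg]
      linear_combination this
    obtain ⟨u, v, huv⟩ := hcop
    refine IsUnit.of_mul_eq_one (AdjoinRoot.mk f v) ?_
    have := congrArg (AdjoinRoot.mk f) huv
    rw [map_add, map_mul, map_mul, AdjoinRoot.mk_self, mul_zero, zero_add, map_one] at this
    rw [mul_comm, this]
  have hnil : IsNilpotent (aeval (AdjoinRoot.mk f q₀) P) := by
    refine ⟨Multiset.card s, ?_⟩
    have : aeval (AdjoinRoot.mk f q₀) P = AdjoinRoot.mk f (q₀ ^ m - X) := by
      rw [hP, map_sub, map_pow]
    rw [this, ← map_pow]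
    exact AdjoinRoot.mk_eq_zero.mpr hdvd
  have hunit : IsUnit (AdjoinRoot.mk f q₀) := by
    have h1 : IsUnit (aeval (AdjoinRoot.mk f q₀) P + x) :=
      hnil.isUnit_add_right_of_commute hX (Commute.all _ _)
    have h2 : aeval (AdjoinRoot.mk f q₀) P + x = AdjoinRoot.mk f q₀ ^ m := by
      rw [hP, sub_add_cancel]
    rw [h2] at h1
    exact (isUnit_pow_iff hm.ne').mp h1
  have hder : IsUnit (aeval (AdjoinRoot.mk f q₀) (derivative P)) := by
    have hmu : IsUnit (m : AdjoinRoot f) := by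
      have h := (IsUnit.mk0 (m : ℝ) (by positivity)).map (algebraMap ℝ (AdjoinRoot f))
      simpa using h
    rw [coe_aeval_eq_eval]
    simpa [P, derivative_X_pow] using And.intro hmu (hunit.pow (m - 1))
  obtain ⟨r, ⟨hr, hr0⟩, -⟩ := existsUnique_nilpotent_sub_and_aeval_eq_zero hnil hder
  have hru : IsUnit r := by
    have : r ^ m = x := by rwa [hP, sub_eq_zero] at hr0
    exact (isUnit_pow_iff hm.ne').mp (this ▸ hX)
  obtain ⟨r', hr'⟩ := hru.exists_right_inv
  obtain ⟨q, rfl⟩ := AdjoinRoot.mk_surjective r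
  obtain ⟨q', rfl⟩ := AdjoinRoot.mk_surjective r'
  refine ⟨q, q', AdjoinRoot.mk_eq_zero.mp ?_, AdjoinRoot.mk_eq_zero.mp ?_⟩
  · rwa [hP, hxdef, ← map_pow, ← map_sub] at hr0
  · simpa [sub_eq_zero] using hr'

theorem exists_real_polynomial_root {ι : Type*} [Fintype ι] [DecidableEq ι] (D : Matrix ι ι ℂ)
    (hD : ∀ μ ∈ spectrum ℂ D, μ.im = 0 ∧ 0 < μ.re) {m : ℕ} (hm : 0 < m) :
    ∃ q q' : ℝ[X], aeval D q ^ m = D ∧ aeval D q * aeval D q' = 1 := by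
  have hroots : ∀ z ∈ D.charpoly.roots, z.im = 0 ∧ 0 < z.re := fun z hz =>
    hD z (Matrix.mem_spectrum_iff_isRoot_charpoly.mpr (isRoot_of_mem_roots hz))
  obtain ⟨q, q', h1, h2⟩ := exists_pow_root_mod (f := ((D.charpoly.roots.map Complex.re).map
    fun a => X - C a).prod) rfl (by
      intro a ha
      obtain ⟨z, hz, rfl⟩ := Multiset.mem_map.mp ha
      exact (hroots z hz).2) hm
  have hmap : (((D.charpoly.roots.map Complex.re).map fun a => X - C a).prod).map
      (algebraMap ℝ ℂ) = D.charpoly := by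
    rw [Polynomial.map_multiset_prod, Multiset.map_map, Multiset.map_map]
    conv_rhs => rw [(IsAlgClosed.splits D.charpoly).eq_prod_roots_of_monic D.charpoly_monic]
    congr 1
    refine Multiset.map_congr rfl fun z hz => ?_
    have : ((z.re : ℝ) : ℂ) = z := Complex.ext rfl (by simp [(hroots z hz).1])
    simp [this]
  have hzero : aeval D ((D.charpoly.roots.map Complex.re).map fun a => X - C a).prod = 0 := by
    rw [← aeval_map_algebraMap ℂ, hmap, Matrix.aeval_self_charpoly]
  refine ⟨q, q', ?_, ?_⟩
  · have := aeval_eq_zero_of_dvd_aeval_eq_zero h1 hzero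
    simpa [sub_eq_zero] using this
  · have := aeval_eq_zero_of_dvd_aeval_eq_zero h2 hzero
    simpa [sub_eq_zero] using this

end RealRoot

/-- The matrix `P` for which `v ↦ P * conj v` is the quaternionic structure on `ℂ^{2n}`
whose commutant is `Ω_{2n}`. -/
def quatJ (n : ℕ) : Matrix (Fin (2 * n)) (Fin (2 * n)) ℂ :=
  Matrix.reindex (finTwoMul n) (finTwoMul n) (Matrix.fromBlocks 0 (-1) 1 0)

theorem quatJ_mul_self (n : ℕ) : quatJ n * quatJ n = -1 := by
  have h : (fromBlocks 0 (-1) 1 0 * fromBlocks 0 (-1) 1 0 :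
      Matrix (Fin n ⊕ Fin n) (Fin n ⊕ Fin n) ℂ) = -1 := by
    rw [fromBlocks_multiply, ← fromBlocks_one, fromBlocks_neg]; simp
  rw [quatJ, reindex_apply, submatrix_mul_equiv, h]
  ext i j
  simp [Matrix.one_apply]

theorem quatJ_transpose (n : ℕ) : (quatJ n)ᵀ = -quatJ n := by
  change reindex _ _ (fromBlocks 0 (-1) 1 0)ᵀ = reindex _ _ (-fromBlocks 0 (-1) 1 0)
  rw [fromBlocks_transpose, fromBlocks_neg]; simp

theorem quatJ_map_conj (n : ℕ) : (quatJ n).map (starRingEnd ℂ) = quatJ n := by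
  change reindex _ _ ((fromBlocks 0 (-1) 1 0).map (starRingEnd ℂ)) = _
  rw [fromBlocks_map, quatJ, Matrix.map_neg _ (map_neg _)]; simp

theorem inOmega_iff {n : ℕ} {M : Matrix (Fin (2 * n)) (Fin (2 * n)) ℂ} :
    InOmega M ↔ M * quatJ n = quatJ n * M.map (starRingEnd ℂ) := by
  obtain ⟨N, rfl⟩ := (Matrix.reindex (finTwoMul n) (finTwoMul n)).surjective M
  obtain ⟨A, B, C, D, rfl⟩ : ∃ A B C D, N = fromBlocks A B C D :=
    ⟨_, _, _, _, (fromBlocks_toBlocks N).symm⟩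
  have hinj := (Matrix.reindex (α := ℂ) (finTwoMul n) (finTwoMul n)).injective
  have h1 : (reindex (finTwoMul n) (finTwoMul n)) (fromBlocks A B C D) * quatJ n =
      reindex (finTwoMul n) (finTwoMul n) (fromBlocks B (-A) D (-C)) := by
    simp [quatJ, fromBlocks_multiply]
  have h2 : quatJ n * ((reindex (finTwoMul n) (finTwoMul n)) (fromBlocks A B C D)).map
      (starRingEnd ℂ) = reindex (finTwoMul n) (finTwoMul n)
        (fromBlocks (-C.map (starRingEnd ℂ)) (-D.map (starRingEnd ℂ))
          (A.map (starRingEnd ℂ)) (B.map (starRingEnd ℂ))) := by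
    simp [quatJ, fromBlocks_multiply, ← Matrix.submatrix_map, fromBlocks_map]
  rw [h1, h2, hinj.eq_iff, fromBlocks_inj]
  constructor
  · rintro ⟨A₁, A₂, h⟩
    rw [omegaMap, hinj.eq_iff, fromBlocks_inj] at h
    obtain ⟨rfl, rfl, rfl, rfl⟩ := h
    refine ⟨?_, ?_, rfl, ?_⟩ <;> ext <;> simp
  · rintro ⟨h1, -, h3, -⟩
    refine ⟨A, -C, ?_⟩
    rw [omegaMap, hinj.eq_iff, fromBlocks_inj]
    refine ⟨rfl, ?_, by simp, h3⟩
    rw [h1]; ext; simp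

/-- `Ω_{2n}` as a real subalgebra. -/
def omegaSubalgebra (n : ℕ) : Subalgebra ℝ (Matrix (Fin (2 * n)) (Fin (2 * n)) ℂ) where
  carrier := {M | InOmega M}
  mul_mem' := by
    intro a b ha hb
    simp only [Set.mem_ofPred_eq, inOmega_iff, Matrix.map_mul] at *
    rw [mul_assoc, hb, ← mul_assoc, ha, mul_assoc]
  add_mem' := by
    intro a b ha hb
    simp only [Set.mem_ofPred_eq, inOmega_iff] at *
    rw [Matrix.map_add _ (map_add _), add_mul, mul_add, ha, hb]
  algebraMap_mem' := by
    intro r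
    have h : (algebraMap ℝ (Matrix (Fin (2 * n)) (Fin (2 * n)) ℂ) r).map (starRingEnd ℂ) =
        algebraMap ℝ _ r := by
      ext i j
      simp only [Matrix.map_apply, Matrix.algebraMap_matrix_apply]
      split_ifs <;> simp
    simp only [Set.mem_ofPred_eq, inOmega_iff]
    rw [h, Algebra.commutes]

theorem InOmega.inv {n : ℕ} {M : Matrix (Fin (2 * n)) (Fin (2 * n)) ℂ} (hM : InOmega M)
    (hu : IsUnit M) : InOmega M⁻¹ := by
  rw [inOmega_iff] at *
  have hdet := (Matrix.isUnit_iff_isUnit_det M).mp hu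
  have h1 : M.map (starRingEnd ℂ) * M⁻¹.map (starRingEnd ℂ) = 1 := by
    rw [← Matrix.map_mul, Matrix.mul_nonsing_inv _ hdet, Matrix.map_one _ (map_zero _) (map_one _)]
  calc M⁻¹ * quatJ n = M⁻¹ * (quatJ n * M.map (starRingEnd ℂ)) * M⁻¹.map (starRingEnd ℂ) := by
        rw [mul_assoc, mul_assoc, h1, mul_one]
    _ = _ := by rw [← hM, ← mul_assoc M⁻¹, Matrix.nonsing_inv_mul _ hdet, one_mul]

section RealPolynomial

open Polynomial

theorem aeval_mem_of_mem {A : Type*} [Ring A] [Algebra ℝ A] {S : Subalgebra ℝ A} {x : A}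
    (hx : x ∈ S) (p : ℝ[X]) : aeval x p ∈ S :=
  Algebra.adjoin_le (Set.singleton_subset_iff.mpr hx) (aeval_mem_adjoin_singleton ℝ x)

theorem Commute.aeval_right {A : Type*} [Ring A] [Algebra ℝ A] {x y : A} (h : Commute x y)
    (p : ℝ[X]) : Commute x (aeval y p) := by
  have hy : y ∈ Subalgebra.centralizer ℝ {x} := by
    rw [Subalgebra.mem_centralizer_iff]; rintro _ rfl; exact h
  exact (Subalgebra.mem_centralizer_iff ℝ).mp (aeval_mem_of_mem hy p) x rfl

section SelfAdjoint

variable {ι : Type*} [Fintype ι] {H X Y : Matrix ι ι ℂ}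

theorem selfAdjoint_mul_of_commute (hX : H * X = Xᴴ * H) (hY : H * Y = Yᴴ * H)
    (hXY : Commute X Y) : H * (X * Y) = (X * Y)ᴴ * H := by
  rw [hXY.eq, conjTranspose_mul, ← hXY.eq, ← mul_assoc, hX, mul_assoc, hY, mul_assoc]

theorem selfAdjoint_pow [DecidableEq ι] (hX : H * X = Xᴴ * H) (s : ℕ) :
    H * X ^ s = (X ^ s)ᴴ * H := by
  induction s with
  | zero => simp
  | succ s ih => rw [pow_succ]; exact selfAdjoint_mul_of_commute ih hX (Commute.self_pow X s).symm

theorem selfAdjoint_aeval [DecidableEq ι] (hX : H * X = Xᴴ * H) (p : ℝ[X]) :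
    H * aeval X p = (aeval X p)ᴴ * H := by
  induction p using Polynomial.induction_on' with
  | add p q hp hq => simp [mul_add, add_mul, hp, hq]
  | monomial s a =>
    rw [aeval_monomial, ← Algebra.smul_def, conjTranspose_smul, mul_smul_comm, smul_mul_assoc,
      selfAdjoint_pow hX]
    simp

end SelfAdjoint

section ComplexStructure

variable {n : ℕ} {H B : Matrix (Fin (2 * n)) (Fin (2 * n)) ℂ}

theorem neg_spectrum_pos (hspec : ∀ μ ∈ spectrum ℂ B, μ.im = 0 ∧ μ.re < 0) :
    ∀ μ ∈ spectrum ℂ (-B), μ.im = 0 ∧ 0 < μ.re := by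
  intro μ hμ
  rw [← spectrum.neg_eq] at hμ
  simpa using hspec (-μ) hμ

theorem exists_complex_structure_of_root {A : Matrix (Fin (2 * n)) (Fin (2 * n)) ℂ} {m : ℕ}
    (heven : Even m) (hBΩ : InOmega B) (hBsa : H * B = Bᴴ * H)
    (hspec : ∀ μ ∈ spectrum ℂ B, μ.im = 0 ∧ μ.re < 0)
    (hAΩ : InOmega A) (hAsa : H * A = Aᴴ * H) (hAB : A ^ m = B) :
    ∃ T, InOmega T ∧ H * T = Tᴴ * H ∧ Commute T B ∧ T * T = -1 := by
  obtain ⟨r, rfl⟩ := heven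
  obtain ⟨q, q', hq, hqq'⟩ := exists_real_polynomial_root (-B) (neg_spectrum_pos hspec) two_pos
  have hnegsa : H * -B = (-B)ᴴ * H := by simp [hBsa]
  have hcB : Commute (A ^ r) B := by rw [← hAB]; exact Commute.pow_pow_self A r (r + r)
  have hc : Commute (A ^ r) (aeval (-B) q') := (hcB.neg_right).aeval_right q'
  refine ⟨A ^ r * aeval (-B) q', ?_, ?_, ?_, ?_⟩
  · exact (omegaSubalgebra n).mul_mem ((omegaSubalgebra n).pow_mem hAΩ r)
      (aeval_mem_of_mem ((omegaSubalgebra n).neg_mem hBΩ) q')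
  · exact selfAdjoint_mul_of_commute (selfAdjoint_pow hAsa r) (selfAdjoint_aeval hnegsa q') hc
  · exact hcB.mul_left (((Commute.refl B).neg_right).aeval_right q').symm
  · have hcomm : Commute (aeval (-B) q) (aeval (-B) q') := by
      rw [Commute, SemiconjBy, ← map_mul, ← map_mul, mul_comm q]
    have hneg : B = -(aeval (-B) q * aeval (-B) q) := by rw [← sq, hq, neg_neg]
    have hone : aeval (-B) q * aeval (-B) q * (aeval (-B) q' * aeval (-B) q') = 1 := by
      rw [hcomm.mul_mul_mul_comm, hqq', one_mul]
    rw [hc.symm.mul_mul_mul_comm, ← pow_add, hAB]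
    nth_rewrite 1 [hneg]
    rw [neg_mul, hone]

theorem exists_root_of_complex_structure {T : Matrix (Fin (2 * n)) (Fin (2 * n)) ℂ} {m : ℕ}
    (hm : 0 < m) (hBΩ : InOmega B) (hBsa : H * B = Bᴴ * H)
    (hspec : ∀ μ ∈ spectrum ℂ B, μ.im = 0 ∧ μ.re < 0)
    (hTΩ : InOmega T) (hTsa : H * T = Tᴴ * H) (hTB : Commute T B) (hT : T * T = -1) :
    ∃ A, InOmega A ∧ H * A = Aᴴ * H ∧ A ^ m = B := by
  obtain ⟨q, -, hq, -⟩ := exists_real_polynomial_root (-B) (neg_spectrum_pos hspec) hm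
  have hnegsa : H * -B = (-B)ᴴ * H := by simp [hBsa]
  let z : ℂ := Complex.exp (Real.pi / m * Complex.I)
  have hz : z ^ m = -1 := by
    rw [← Complex.exp_nat_mul, ← Complex.exp_pi_mul_I]
    congr 1
    have : (m : ℂ) ≠ 0 := by exact_mod_cast hm.ne'
    field_simp
  let φ := Complex.lift ⟨T, hT⟩
  have hφ : φ z = algebraMap ℝ _ z.re + z.im • T := by simp [φ, Complex.liftAux_apply]
  have hTq : Commute T (aeval (-B) q) := hTB.neg_right.aeval_right q
  have hφq : Commute (φ z) (aeval (-B) q) := by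
    rw [hφ]
    exact Commute.add_left (Algebra.commutes _ _) (hTq.smul_left _)
  refine ⟨φ z * aeval (-B) q, ?_, ?_, ?_⟩
  · refine (omegaSubalgebra n).mul_mem ?_ (aeval_mem_of_mem ((omegaSubalgebra n).neg_mem hBΩ) q)
    rw [hφ]
    exact (omegaSubalgebra n).add_mem ((omegaSubalgebra n).algebraMap_mem _)
      ((omegaSubalgebra n).smul_mem hTΩ _)
  · refine selfAdjoint_mul_of_commute ?_ (selfAdjoint_aeval hnegsa q) hφq
    rw [hφ, Algebra.algebraMap_eq_smul_one]
    simp [mul_add, add_mul, hTsa]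
  · rw [hφq.mul_pow, ← map_pow, hz, hq]
    simp

end ComplexStructure

end RealPolynomial

section Chains

variable {C : Type*} [DecidableEq C] {K : C → ℕ}

/-- Direct sum of Jordan blocks, indexed by pairs (block, position). -/
def jordanSum (K : C → ℕ) (L : C → ℂ) : Matrix (Σ c, Fin (K c)) (Σ c, Fin (K c)) ℂ :=
  Matrix.of fun x y => if x.1 = y.1 then
    (if (x.2 : ℕ) = y.2 then L x.1 else if (x.2 : ℕ) + 1 = y.2 then 1 else 0) else 0

/-- The sign `±1` encoded by a Boolean. -/
def boolSign (b : Bool) : ℂ := if b then -1 else 1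

/-- Direct sum of signed sip matrices, indexed by pairs (block, position). -/
def sipSum (K : C → ℕ) (sgn : C → Bool) : Matrix (Σ c, Fin (K c)) (Σ c, Fin (K c)) ℂ :=
  Matrix.of fun x y => if x.1 = y.1 ∧ (x.2 : ℕ) + y.2 = K x.1 - 1 then boolSign (sgn x.1) else 0

theorem boolSign_mul_self (b : Bool) : boolSign b * boolSign b = 1 := by cases b <;> simp [boolSign]

theorem boolSign_ne_zero (b : Bool) : boolSign b ≠ 0 := by cases b <;> simp [boolSign]

theorem boolSign_not (b : Bool) : boolSign (!b) = -boolSign b := by cases b <;> simp [boolSign]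

theorem eq_of_boolSign_mul_eq_one {a b : Bool} (h : boolSign a * boolSign b = 1) : a = b := by
  cases a <;> cases b <;> simp [boolSign] at h ⊢ <;> norm_num at h

theorem star_boolSign (b : Bool) : star (boolSign b) = boolSign b := by
  cases b <;> simp [boolSign]

theorem chain_ext {C : Type*} {K : C → ℕ} {x y : Σ c, Fin (K c)} (h₁ : x.1 = y.1)
    (h₂ : (x.2 : ℕ) = y.2) : x = y := by
  obtain ⟨c, p⟩ := x
  obtain ⟨c', p'⟩ := y
  obtain rfl : c = c' := h₁
  obtain rfl : p = p' := Fin.ext h₂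
  rfl

/-- A signed involution of the basis which commutes with the Jordan and sip matrices permutes
the chains. -/
theorem exists_chain_involution {L : C → ℂ} {sgn : C → Bool}
    {σ : (Σ c, Fin (K c)) → Σ c, Fin (K c)} {half : (Σ c, Fin (K c)) → Bool}
    (hσ : ∀ x, σ (σ x) = x) (hhalf : ∀ x, half (σ x) = !half x)
    (hJ : ∀ x y, jordanSum K L (σ x) (σ y) =
      boolSign (half x) * boolSign (half y) * jordanSum K L x y)
    (hQ : ∀ x y, sipSum K sgn (σ x) (σ y) =
      boolSign (half x) * boolSign (half y) * sipSum K sgn x y) :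
    ∃ (ρ : {c // 0 < K c} → {c // 0 < K c}) (h : {c // 0 < K c} → Bool),
      (∀ c, ρ (ρ c) = c) ∧ (∀ c, h (ρ c) = !h c) ∧ (∀ c, K (ρ c) = K c) ∧
      (∀ c, L (ρ c) = L c) ∧ (∀ c, sgn (ρ c) = sgn c) ∧
      ∀ (c : {c // 0 < K c}) (p : Fin (K c)), (σ ⟨c, p⟩).1 = ρ c ∧ ((σ ⟨c, p⟩).2 : ℕ) = p ∧
        half ⟨c, p⟩ = h c := by
  let first : {c // 0 < K c} → Σ c, Fin (K c) := fun c => ⟨c, ⟨0, c.2⟩⟩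
  let ρ : {c // 0 < K c} → {c // 0 < K c} := fun c =>
    ⟨(σ (first c)).1, (Nat.zero_le _).trans_lt (σ (first c)).2.2⟩
  have hinj : Function.Injective σ := fun x y h => by rw [← hσ x, h, hσ]
  have hfirst : ∀ c, ((σ (first c)).2 : ℕ) = 0 := by
    intro c
    by_contra h0
    let y : Σ c, Fin (K c) := ⟨(σ (first c)).1, ⟨(σ (first c)).2 - 1, by omega⟩⟩
    have hy : jordanSum K L y (σ (first c)) = 1 := by
      have h1 : ¬ (((σ (first c)).2 : ℕ) - 1 = (σ (first c)).2) := by omega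
      have h2 : ((σ (first c)).2 : ℕ) - 1 + 1 = (σ (first c)).2 := by omega
      simp [jordanSum, y, h1, h2]
    have h1 := hJ y (σ (first c))
    rw [hσ, hy, mul_one] at h1
    have hne : jordanSum K L (σ y) (first c) ≠ 0 := by
      rw [h1]; exact mul_ne_zero (boolSign_ne_zero _) (boolSign_ne_zero _)
    by_cases hc : (σ y).1 = (first c).1
    · by_cases hp : ((σ y).2 : ℕ) = (first c).2
      · have := chain_ext hc hp
        have : y = σ (first c) := by rw [← this, hσ]
        have := congrArg (fun z : Σ c, Fin (K c) => (z.2 : ℕ)) this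
        simp only [y] at this
        omega
      · exact hne (by simp [jordanSum, hc, first] at hp ⊢; simp [hp])
    · exact hne (by simp [jordanSum, hc])
  have hchain : ∀ (c : {c // 0 < K c}) (p : ℕ) (hp : p < K c), (σ ⟨c, p, hp⟩).1 = ρ c ∧
      ((σ ⟨c, p, hp⟩).2 : ℕ) = p ∧ half ⟨c, p, hp⟩ = half (first c) := by
    intro c p
    induction p with
    | zero => exact fun hp => ⟨rfl, hfirst c, rfl⟩
    | succ p ih =>
      intro hp
      obtain ⟨h1, h2, h3⟩ := ih (by omega)
      have hJ' := hJ ⟨c, p, by omega⟩ ⟨c, p + 1, hp⟩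
      have hone : jordanSum K L ⟨c, p, by omega⟩ ⟨c, p + 1, hp⟩ = 1 := by simp [jordanSum]
      rw [hone, mul_one] at hJ'
      have hne := mul_ne_zero (boolSign_ne_zero (half ⟨c, p, by omega⟩))
        (boolSign_ne_zero (half ⟨c, p + 1, hp⟩))
      rw [← hJ'] at hne
      by_cases hc : (σ ⟨c, p, by omega⟩).1 = (σ ⟨c, p + 1, hp⟩).1
      · by_cases hq : ((σ ⟨c, p, by omega⟩).2 : ℕ) = (σ ⟨c, p + 1, hp⟩).2
        · have := hinj (chain_ext hc hq)
          simp at this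
        · by_cases hq' : ((σ ⟨c, p, by omega⟩).2 : ℕ) + 1 = (σ ⟨c, p + 1, hp⟩).2
          · refine ⟨hc.symm.trans h1, by omega, ?_⟩
            rw [← h3]
            have hone' : jordanSum K L (σ ⟨c, p, by omega⟩) (σ ⟨c, p + 1, hp⟩) = 1 := by
              simp only [jordanSum, Matrix.of_apply, if_pos hc, if_neg hq, if_pos hq']
            exact (eq_of_boolSign_mul_eq_one (hJ'.symm.trans hone')).symm
          · exact absurd (by simp only [jordanSum, Matrix.of_apply, if_pos hc, if_neg hq,
              if_neg hq']) hne
      · exact absurd (by simp only [jordanSum, Matrix.of_apply, if_neg hc]) hne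
  have hσfirst : ∀ c, σ (first c) = first (ρ c) := fun c => chain_ext rfl (hfirst c)
  have hρ : ∀ c, ρ (ρ c) = c := by
    intro c
    apply Subtype.ext
    change (σ (first (ρ c))).1 = c
    rw [← hσfirst, hσ]
  have hKle : ∀ c : {c // 0 < K c}, K c ≤ K (ρ c) := by
    intro c
    obtain ⟨h1, h2, -⟩ := hchain c (K c - 1) (by have := c.2; omega)
    have := (σ ⟨c, ⟨K c - 1, by have := c.2; omega⟩⟩).2.2
    rw [h2, h1] at this
    omega
  have hK : ∀ c : {c // 0 < K c}, K (ρ c) = K c := fun c =>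
    le_antisymm (by have := hKle (ρ c); rwa [hρ] at this) (hKle c)
  refine ⟨ρ, fun c => half (first c), hρ, fun c => ?_, hK, fun c => ?_, fun c => ?_,
    fun c p => hchain c p p.2⟩
  · change half (first (ρ c)) = _
    rw [← hσfirst, hhalf]
  · have := hJ (first c) (first c)
    rw [boolSign_mul_self, one_mul, hσfirst] at this
    simpa [jordanSum, first] using this
  · have hlt : K c - 1 < K c := by have := c.2; omega
    have h := hQ (first c) ⟨c, K c - 1, hlt⟩
    obtain ⟨h1, h2, h3⟩ := hchain c (K c - 1) hlt
    rw [h3, boolSign_mul_self, one_mul, hσfirst] at h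
    have e1 : sipSum K sgn (first c) ⟨c, K c - 1, hlt⟩ = boolSign (sgn c) := by
      simp [sipSum, first]
    have e2 : sipSum K sgn (first (ρ c)) (σ ⟨c, K c - 1, hlt⟩) = boolSign (sgn (ρ c)) := by
      simp only [sipSum, first, Matrix.of_apply]
      rw [if_pos ⟨h1.symm, by rw [h2, hK, zero_add]⟩]
    rw [e1, e2] at h
    exact eq_of_boolSign_mul_eq_one (h ▸ boolSign_mul_self _)

end Chains

section Pairing

/-- A finite type whose fibres are balanced with respect to a Boolean function carries an
involution flipping that function. -/
theorem exists_flip_of_card_eq {F κ : Type*} [Finite F] (key : F → κ) (sgn : F → Bool)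
    (h : ∀ a, Nat.card {x // key x = a ∧ sgn x = true} =
      Nat.card {x // key x = a ∧ sgn x = false}) :
    ∃ τ : F → F, (∀ x, τ (τ x) = x) ∧ (∀ x, key (τ x) = key x) ∧ ∀ x, sgn (τ x) = !sgn x := by
  have hfib : ∀ (b : Bool) (a : κ), Nat.card {x : {x // sgn x = b} // key x = a} =
      Nat.card {x // key x = a ∧ sgn x = b} := fun b a =>
    Nat.card_congr ⟨fun x => ⟨x.1.1, x.2, x.1.2⟩, fun x => ⟨⟨x.1, x.2.2⟩, x.2.1⟩,
      fun _ => rfl, fun _ => rfl⟩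
  have he : ∀ a, Nonempty ({x : {x // sgn x = true} // key x = a} ≃
      {x : {x // sgn x = false} // key x = a}) := fun a =>
    Finite.card_eq.mp (by rw [hfib, hfib, h])
  let e := fun a => (he a).some
  let φ : {x // sgn x = true} ≃ {x // sgn x = false} :=
    Equiv.ofFiberEquiv (f := fun x : {x // sgn x = true} => key x)
      (g := fun x : {x // sgn x = false} => key x) e
  have hφ : ∀ x, key (φ x) = key x := fun x => Equiv.ofFiberEquiv_map e x
  have hφ' : ∀ x, key (φ.symm x) = key x := fun x => by
    rw [← hφ, Equiv.apply_symm_apply]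
  let τ : F → F := fun x => if hx : sgn x = true then φ ⟨x, hx⟩
    else φ.symm ⟨x, Bool.eq_false_iff.mpr hx⟩
  have ht : ∀ x (hx : sgn x = true), τ x = φ ⟨x, hx⟩ := fun x hx => dif_pos hx
  have hf : ∀ x (hx : sgn x = false), τ x = φ.symm ⟨x, hx⟩ := fun x hx =>
    dif_neg (by simp [hx])
  refine ⟨τ, fun x => ?_, fun x => ?_, fun x => ?_⟩
  · cases hx : sgn x
    · rw [hf x hx, ht _ (φ.symm ⟨x, hx⟩).2]; simp
    · rw [ht x hx, hf _ (φ ⟨x, hx⟩).2]; simp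
  · cases hx : sgn x
    · rw [hf x hx, hφ']
    · rw [ht x hx, hφ]
  · cases hx : sgn x
    · rw [hf x hx, (φ.symm ⟨x, hx⟩).2]; rfl
    · rw [ht x hx, (φ ⟨x, hx⟩).2]; rfl

/-- Given an involution `ρ` preserving `key` and `sgn` and reversing `h`, and an involution
preserving `key` and reversing `sgn`, there is an involution preserving `key` and `h`,
reversing `sgn`, and commuting with `ρ`. -/
theorem exists_equivariant_flip {F κ : Type*} [Finite F] (key : F → κ) (sgn h : F → Bool)
    {ρ ν : F → F} (hρ : ∀ x, ρ (ρ x) = x) (hρk : ∀ x, key (ρ x) = key x)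
    (hρs : ∀ x, sgn (ρ x) = sgn x) (hρh : ∀ x, h (ρ x) = !h x)
    (hν : ∀ x, ν (ν x) = x) (hνk : ∀ x, key (ν x) = key x) (hνs : ∀ x, sgn (ν x) = !sgn x) :
    ∃ τ : F → F, (∀ x, τ (τ x) = x) ∧ (∀ x, key (τ x) = key x) ∧ (∀ x, sgn (τ x) = !sgn x) ∧
      (∀ x, h (τ x) = h x) ∧ ∀ x, τ (ρ x) = ρ (τ x) := by
  have hsplit : ∀ a b, Nat.card {x // key x = a ∧ sgn x = b} =
      2 * Nat.card {x : {x // h x = false} // key x = a ∧ sgn x = b} := by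
    intro a b
    rw [two_mul, ← Nat.card_sum]
    refine Nat.card_congr (Equiv.symm ⟨Sum.elim (fun x => ⟨x.1.1, x.2⟩)
      (fun x => ⟨ρ x.1.1, by rw [hρk, hρs]; exact x.2⟩),
      fun x => if hx : h x = false then Sum.inl ⟨⟨x, hx⟩, x.2⟩
        else Sum.inr ⟨⟨ρ x, by rw [hρh]; simpa using hx⟩, by rw [hρk, hρs]; exact x.2⟩, ?_, ?_⟩)
    · rintro (⟨⟨x, hx⟩, h1⟩ | ⟨⟨x, hx⟩, h1⟩)
      · simp [hx]
      · simp [hx, hρ, hρh]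
    · rintro ⟨x, hx⟩
      by_cases hh : h x = false <;> simp [hh, hρ]
  have hflip : ∀ a, Nat.card {x // key x = a ∧ sgn x = true} =
      Nat.card {x // key x = a ∧ sgn x = false} := fun a =>
    Nat.card_congr ⟨fun x => ⟨ν x, by rw [hνk, hνs, x.2.1, x.2.2]; simp⟩,
      fun x => ⟨ν x, by rw [hνk, hνs, x.2.1, x.2.2]; simp⟩,
      fun x => Subtype.ext (hν x), fun x => Subtype.ext (hν x)⟩
  obtain ⟨τ, hτ, hτk, hτs⟩ := exists_flip_of_card_eq (F := {x // h x = false})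
    (fun x => key x) (fun x => sgn x) (fun a => by
      have h1 := hsplit a true
      have h2 := hsplit a false
      have h3 := hflip a
      omega)
  have hρf : ∀ x, ¬ h x = false → h (ρ x) = false := fun x hx => by rw [hρh]; simpa using hx
  let τ' : F → F := fun x => if hx : h x = false then τ ⟨x, hx⟩ else ρ (τ ⟨ρ x, hρf x hx⟩)
  have hf : ∀ x (hx : h x = false), τ' x = τ ⟨x, hx⟩ := fun x hx => dif_pos hx
  have ht : ∀ x (hx : ¬ h x = false), τ' x = ρ (τ ⟨ρ x, hρf x hx⟩) := fun x hx => dif_neg hx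
  have htneg : ∀ x : {x // h x = false}, ¬ h (ρ x) = false := fun x => by
    rw [hρh, x.2]; simp
  refine ⟨τ', fun x => ?_, fun x => ?_, fun x => ?_, fun x => ?_, fun x => ?_⟩
  · by_cases hx : h x = false
    · rw [hf x hx, hf _ (τ ⟨x, hx⟩).2]; simp [hτ]
    · rw [ht x hx, ht _ (htneg _)]; simp [hτ, hρ]
  · by_cases hx : h x = false
    · rw [hf x hx, hτk]
    · rw [ht x hx, hρk, hτk, hρk]
  · by_cases hx : h x = false
    · rw [hf x hx, hτs]
    · rw [ht x hx, hρs, hτs, hρs]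
  · by_cases hx : h x = false
    · rw [hf x hx, (τ ⟨x, hx⟩).2, hx]
    · rw [ht x hx, hρh, (τ _).2]; simpa using hx
  · by_cases hx : h x = false
    · rw [hf x hx, ht _ (htneg ⟨x, hx⟩)]; simp [hρ]
    · rw [ht x hx, hf _ (hρf x hx), hρ]

end Pairing

section Swap

variable {n : ℕ}

/-- Exchange of the two halves of `Fin (2 * n)`. -/
def swapHalf (n : ℕ) : Fin (2 * n) ≃ Fin (2 * n) :=
  (finTwoMul n).symm.trans ((Equiv.sumComm _ _).trans (finTwoMul n))

/-- Whether an index lies in the second half of `Fin (2 * n)`. -/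
def inRightHalf (i : Fin (2 * n)) : Bool := ((finTwoMul n).symm i).isRight

theorem swapHalf_swapHalf (i : Fin (2 * n)) : swapHalf n (swapHalf n i) = i := by
  simp [swapHalf]

theorem inRightHalf_swapHalf (i : Fin (2 * n)) : inRightHalf (swapHalf n i) = !inRightHalf i := by
  simp [swapHalf, inRightHalf]

theorem inOmega_iff_swapHalf {M : Matrix (Fin (2 * n)) (Fin (2 * n)) ℂ} :
    InOmega M ↔ ∀ i j, M (swapHalf n i) (swapHalf n j) =
      boolSign (inRightHalf i) * boolSign (inRightHalf j) * star (M i j) := by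
  constructor
  · rintro ⟨A₁, A₂, rfl⟩
    intro i j
    obtain ⟨i, rfl⟩ := (finTwoMul n).surjective i
    obtain ⟨j, rfl⟩ := (finTwoMul n).surjective j
    rcases i with i | i <;> rcases j with j | j <;>
      simp [swapHalf, inRightHalf, omegaMap, boolSign]
  · intro h
    refine ⟨Matrix.of fun i j => M (finTwoMul n (Sum.inl i)) (finTwoMul n (Sum.inl j)),
      Matrix.of fun i j => -M (finTwoMul n (Sum.inr i)) (finTwoMul n (Sum.inl j)), ?_⟩
    ext i j
    obtain ⟨i, rfl⟩ := (finTwoMul n).surjective i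
    obtain ⟨j, rfl⟩ := (finTwoMul n).surjective j
    rcases i with i | i <;> rcases j with j | j
    · simp [omegaMap]
    · have := h (finTwoMul n (Sum.inr i)) (finTwoMul n (Sum.inl j))
      simpa [swapHalf, inRightHalf, omegaMap, boolSign] using this
    · simp [omegaMap]
    · have := h (finTwoMul n (Sum.inl i)) (finTwoMul n (Sum.inl j))
      simpa [swapHalf, inRightHalf, omegaMap, boolSign] using this

theorem InOmega.conjTranspose {M : Matrix (Fin (2 * n)) (Fin (2 * n)) ℂ} (hM : InOmega M) :
    InOmega Mᴴ := by
  rw [inOmega_iff_swapHalf] at *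
  intro i j
  rw [conjTranspose_apply, conjTranspose_apply, hM, star_mul', star_mul', star_boolSign,
    star_boolSign, mul_comm (boolSign _)]

end Swap

section CanonicalForm

variable {C : Type*} [Fintype C] [DecidableEq C] {K : C → ℕ}

theorem exists_complex_structure_of_canonical {L : C → ℝ} {sgn : C → Bool} {ν : C → C}
    (hν : ∀ c, ν (ν c) = c) (hνK : ∀ c, K (ν c) = K c) (hνL : ∀ c, L (ν c) = L c)
    (hνs : ∀ c, sgn (ν c) = !sgn c) {n : ℕ} (e : (Σ c, Fin (K c)) ≃ Fin (2 * n))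
    (hJ : InOmega (reindex e e (jordanSum K fun c => (L c : ℂ))))
    (hQ : InOmega (reindex e e (sipSum K sgn))) :
    ∃ T : Matrix (Σ c, Fin (K c)) (Σ c, Fin (K c)) ℂ, InOmega (reindex e e T) ∧
      sipSum K sgn * T = Tᴴ * sipSum K sgn ∧
      Commute T (jordanSum K fun c => (L c : ℂ)) ∧ T * T = -1 := by
  let σ : (Σ c, Fin (K c)) → Σ c, Fin (K c) := fun x => e.symm (swapHalf n (e x))
  let half : (Σ c, Fin (K c)) → Bool := fun x => inRightHalf (e x)
  have hσ : ∀ x, σ (σ x) = x := fun x => by simp [σ, swapHalf_swapHalf]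
  have hhalf : ∀ x, half (σ x) = !half x := fun x => by simp [σ, half, inRightHalf_swapHalf]
  have key : ∀ M : Matrix (Σ c, Fin (K c)) (Σ c, Fin (K c)) ℂ, InOmega (reindex e e M) ↔
      ∀ x y, M (σ x) (σ y) = boolSign (half x) * boolSign (half y) * star (M x y) := by
    intro M
    rw [inOmega_iff_swapHalf]
    constructor
    · intro h x y
      simpa using h (e x) (e y)
    · intro h x y
      simpa [σ, half] using h (e.symm x) (e.symm y)
  rw [key] at hJ hQ
  obtain ⟨ρ, h, hρ, hρh, hρK, hρL, hρs, hρσ⟩ := exists_chain_involution (L := fun c => (L c : ℂ))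
    (sgn := sgn) hσ hhalf
    (fun x y => by
      rw [hJ]
      congr 1
      simp only [jordanSum, Matrix.of_apply]
      split_ifs <;> simp)
    (fun x y => by
      rw [hQ]
      congr 1
      simp only [sipSum, Matrix.of_apply]
      split_ifs <;> simp [star_boolSign])
  obtain ⟨τ, hτ, hτk, hτs, hτh, hτρ⟩ := exists_equivariant_flip
    (fun c : {c // 0 < K c} => (K c, L c)) (fun c => sgn c) h hρ
    (fun c => Prod.ext (hρK c) (by simpa using hρL c)) hρs hρh
    (ν := fun c => ⟨ν c, by rw [hνK]; exact c.2⟩) (fun c => Subtype.ext (hν c))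
    (fun c => Prod.ext (hνK c) (hνL c)) (fun c => hνs c)
  have hτK : ∀ c, K (τ c) = K c := fun c => congrArg Prod.fst (hτk c)
  have hτL : ∀ c, L (τ c) = L c := fun c => congrArg Prod.snd (hτk c)
  let blk : (Σ c, Fin (K c)) → {c // 0 < K c} := fun x => ⟨x.1, (Nat.zero_le _).trans_lt x.2.2⟩
  let t : (Σ c, Fin (K c)) → Σ c, Fin (K c) := fun x =>
    ⟨τ (blk x), ⟨x.2, by rw [hτK]; exact x.2.2⟩⟩
  have ht : ∀ x, t (t x) = x := fun x => chain_ext (congrArg Subtype.val (hτ (blk x))) rfl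
  have hts : ∀ x, sgn (t x).1 = !sgn x.1 := fun x => hτs (blk x)
  have htσ : ∀ x, t (σ x) = σ (t x) := by
    intro x
    have h1 := hρσ (blk x) x.2
    have h2 := hρσ (blk (t x)) (t x).2
    refine chain_ext ?_ ?_
    · refine Eq.trans ?_ h2.1.symm
      rw [show blk (t x) = τ (blk x) from rfl, ← hτρ]
      exact congrArg (fun c => (τ c : C)) (Subtype.ext h1.1)
    · exact h1.2.1.trans h2.2.1.symm
  have hthalf : ∀ x, half (t x) = half x := by
    intro x
    exact (hρσ (blk (t x)) (t x).2).2.2.trans ((hτh (blk x)).trans (hρσ (blk x) x.2).2.2.symm)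
  have htinj : ∀ x y, t x = t y ↔ x = y := fun x y =>
    ⟨fun h => by rw [← ht x, h, ht], congrArg t⟩
  have htJ : ∀ x y, jordanSum K (fun c => (L c : ℂ)) (t x) (t y) =
      jordanSum K (fun c => (L c : ℂ)) x y := by
    intro x y
    have h1 : (t x).1 = (t y).1 ↔ x.1 = y.1 := by
      simp only [t, Subtype.coe_inj]
      exact ⟨fun h => congrArg Subtype.val (by rw [← hτ (blk x), h, hτ] : blk x = blk y),
        fun h => congrArg τ (Subtype.ext h)⟩
    have h2 : L (t x).1 = L x.1 := hτL (blk x)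
    simp only [jordanSum, Matrix.of_apply, h1, h2]
    rfl
  have htQ : ∀ x y, sipSum K sgn (t x) (t y) = -sipSum K sgn x y := by
    intro x y
    have h1 : (t x).1 = (t y).1 ↔ x.1 = y.1 := by
      simp only [t, Subtype.coe_inj]
      exact ⟨fun h => congrArg Subtype.val (by rw [← hτ (blk x), h, hτ] : blk x = blk y),
        fun h => congrArg τ (Subtype.ext h)⟩
    have h2 : K (t x).1 = K x.1 := hτK (blk x)
    simp only [sipSum, Matrix.of_apply, h1, h2, hts, boolSign_not]
    split_ifs <;> simp_all [t]
  let T : Matrix (Σ c, Fin (K c)) (Σ c, Fin (K c)) ℂ :=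
    Matrix.of fun x y => if x = t y then boolSign (sgn y.1) else 0
  have hMT : ∀ (M : Matrix (Σ c, Fin (K c)) (Σ c, Fin (K c)) ℂ) x y,
      (M * T) x y = M x (t y) * boolSign (sgn y.1) := by
    intro M x y
    simp [Matrix.mul_apply, T]
  have hTM : ∀ (M : Matrix (Σ c, Fin (K c)) (Σ c, Fin (K c)) ℂ) x y,
      (T * M) x y = -boolSign (sgn x.1) * M (t x) y := by
    intro M x y
    have : ∀ z, x = t z ↔ t x = z := fun z => by rw [← htinj, ht]
    simp [Matrix.mul_apply, T, this, hts, boolSign_not]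
  have hTh : Tᴴ = -T := by
    ext x y
    have : y = t x ↔ x = t y := by rw [← htinj, ht, eq_comm]
    simp only [conjTranspose_apply, T, Matrix.of_apply, Matrix.neg_apply, this]
    split_ifs with hxy
    · rw [star_boolSign, hxy, hts, boolSign_not]
    · simp
  refine ⟨T, ?_, ?_, ?_, ?_⟩
  · rw [key]
    intro x y
    have h1 : σ x = t (σ y) ↔ x = t y := by
      rw [htσ]
      exact ⟨fun h => by rw [← hσ x, h, hσ], congrArg σ⟩
    have h2 : sgn (σ y).1 = sgn y.1 := by
      rw [(hρσ (blk y) y.2).1]; exact hρs (blk y)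
    simp only [T, Matrix.of_apply, h1, h2]
    split_ifs with hxy
    · rw [hxy, hthalf, boolSign_mul_self, one_mul, star_boolSign]
    · simp
  · rw [hTh]
    ext x y
    rw [hMT, neg_mul, Matrix.neg_apply, hTM]
    have := htQ x (t y)
    rw [ht] at this
    rw [this]
    by_cases hxy : x.1 = (t y).1
    · rw [hxy, hts, boolSign_not]; ring
    · simp [sipSum, hxy]
  · ext x y
    rw [hTM, hMT]
    have := htJ x (t y)
    rw [ht] at this
    rw [this]
    by_cases hxy : x.1 = (t y).1
    · rw [hxy, hts, boolSign_not]; ring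
    · simp [jordanSum, hxy]
  · ext x y
    rw [hMT]
    simp only [T, Matrix.of_apply, ht]
    by_cases hxy : x = y
    · simp [hxy, hts, boolSign_not, boolSign_mul_self]
    · simp [hxy]

end CanonicalForm

section ChainIndex

variable {I : Type*}

/-- Positions in the double blocks of size `2 * k i`, as positions in single blocks. -/
def chainEquiv (k : I → ℕ) : (Σ c : I × Bool, Fin (k c.1)) ≃ Σ i, Fin (2 * k i) where
  toFun x := ⟨x.1.1, finTwoMul _ (bif x.1.2 then Sum.inr x.2 else Sum.inl x.2)⟩
  invFun y := Sum.elim (fun p => ⟨(y.1, false), p⟩) (fun p => ⟨(y.1, true), p⟩)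
    ((finTwoMul _).symm y.2)
  left_inv := by rintro ⟨⟨i, _ | _⟩, p⟩ <;> simp
  right_inv := by
    rintro ⟨i, q⟩
    dsimp only
    generalize hz : (finTwoMul (k i)).symm q = z
    obtain rfl := (Equiv.symm_apply_eq _).mp hz
    rcases z with z | z <;> rfl

variable [DecidableEq I] {Y : Type*} {k : I → ℕ} (e : (Σ i, Fin (2 * k i)) ≃ Y)

theorem reindex_jordanBlocks (L : I → ℂ) :
    reindex e e (blockDiagonal' fun i =>
      dsum2 (jordanBlock (L i) (k i)) (jordanBlock (L i) (k i))) =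
    reindex ((chainEquiv k).trans e) ((chainEquiv k).trans e)
      (jordanSum (fun c : I × Bool => k c.1) fun c => L c.1) := by
  rw [← Equiv.symm_apply_eq]
  ext ⟨⟨i, b⟩, p⟩ ⟨⟨j, d⟩, q⟩
  by_cases h : i = j
  · subst h
    cases b <;> cases d <;> simp [chainEquiv, dsum2, jordanSum, jordanBlock]
  · simp [chainEquiv, jordanSum, blockDiagonal'_apply_ne _ _ _ h, h]

theorem reindex_sipBlocks :
    reindex e e (blockDiagonal' fun i => dsum2 (sip ℂ (k i)) (-sip ℂ (k i))) =
    reindex ((chainEquiv k).trans e) ((chainEquiv k).trans e)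
      (sipSum (fun c : I × Bool => k c.1) fun c => c.2) := by
  rw [← Equiv.symm_apply_eq]
  ext ⟨⟨i, b⟩, p⟩ ⟨⟨j, d⟩, q⟩
  by_cases h : i = j
  · subst h
    cases b <;> cases d <;> simp [chainEquiv, dsum2, sipSum, sip, boolSign]
    split_ifs <;> simp
  · simp [chainEquiv, sipSum, blockDiagonal'_apply_ne _ _ _ h, h]

end ChainIndex

theorem exists_complex_structure_of_similar {I : Type*} [Fintype I] [DecidableEq I] {n : ℕ}
    {H B S : Matrix (Fin (2 * n)) (Fin (2 * n)) ℂ} (hHΩ : InOmega H) (hBΩ : InOmega B)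
    (hSΩ : InOmega S) (hS : IsUnit S) {k : I → ℕ} {L : I → ℝ}
    (e : (Σ c : I × Bool, Fin (k c.1)) ≃ Fin (2 * n))
    (hB : S⁻¹ * B * S =
      reindex e e (jordanSum (fun c : I × Bool => k c.1) fun c => (L c.1 : ℂ)))
    (hH : Sᴴ * H * S = reindex e e (sipSum (fun c : I × Bool => k c.1) fun c => c.2)) :
    ∃ T, InOmega T ∧ H * T = Tᴴ * H ∧ Commute T B ∧ T * T = -1 := by
  have mul_mem : ∀ {X Y : Matrix (Fin (2 * n)) (Fin (2 * n)) ℂ}, InOmega X → InOmega Y →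
    InOmega (X * Y) := (omegaSubalgebra n).mul_mem
  have hSi := hSΩ.inv hS
  obtain ⟨T, hTΩ, hTQ, hTJ, hTT⟩ := exists_complex_structure_of_canonical
    (K := fun c : I × Bool => k c.1) (L := fun c => L c.1) (sgn := fun c => c.2)
    (ν := fun c => (c.1, !c.2)) (by simp) (fun _ => rfl) (fun _ => rfl) (fun _ => rfl) e
    (hB ▸ mul_mem (mul_mem hSi hBΩ) hSΩ) (hH ▸ mul_mem (mul_mem hSΩ.conjTranspose hHΩ) hSΩ)
  have hdet := (Matrix.isUnit_iff_isUnit_det S).mp hS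
  have h1 : S⁻¹ * S = 1 := Matrix.nonsing_inv_mul _ hdet
  have h2 : S * S⁻¹ = 1 := Matrix.mul_nonsing_inv _ hdet
  have h3 : S⁻¹ᴴ * Sᴴ = 1 := by rw [← conjTranspose_mul, h2, conjTranspose_one]
  have hmul : ∀ M N : Matrix (Σ c : I × Bool, Fin (k c.1)) (Σ c : I × Bool, Fin (k c.1)) ℂ,
      reindex e e (M * N) = reindex e e M * reindex e e N := fun M N => by simp
  replace hTQ := congrArg (reindex e e) hTQ
  replace hTJ := congrArg (reindex e e) hTJ.eq
  replace hTT := congrArg (reindex e e) hTT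
  rw [hmul, hmul, ← hH, ← conjTranspose_reindex] at hTQ
  rw [hmul, hmul, ← hB] at hTJ
  rw [hmul, show reindex e e (-1 : Matrix _ _ ℂ) = -1 by ext; simp [one_apply]] at hTT
  generalize reindex e e T = R at *
  refine ⟨S * R * S⁻¹, mul_mem (mul_mem hSΩ hTΩ) hSi, ?_, ?_, ?_⟩
  · calc H * (S * R * S⁻¹) = S⁻¹ᴴ * Sᴴ * H * S * R * S⁻¹ := by rw [h3]; noncomm_ring
      _ = S⁻¹ᴴ * (Sᴴ * H * S * R) * S⁻¹ := by noncomm_ring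
      _ = S⁻¹ᴴ * Rᴴ * Sᴴ * H * (S * S⁻¹) := by rw [hTQ]; noncomm_ring
      _ = _ := by rw [h2, conjTranspose_mul, conjTranspose_mul]; noncomm_ring
  · calc S * R * S⁻¹ * B = S * R * S⁻¹ * B * (S * S⁻¹) := by rw [h2, mul_one]
      _ = S * (R * (S⁻¹ * B * S)) * S⁻¹ := by noncomm_ring
      _ = S * S⁻¹ * B * (S * R * S⁻¹) := by rw [hTJ]; noncomm_ring
      _ = _ := by rw [h2, one_mul]
  · calc S * R * S⁻¹ * (S * R * S⁻¹) = S * R * (S⁻¹ * S) * R * S⁻¹ := by noncomm_ring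
      _ = S * (R * R) * S⁻¹ := by rw [h1]; noncomm_ring
      _ = -(S * S⁻¹) := by rw [hTT]; noncomm_ring
      _ = _ := by rw [h2]

section SymplecticChains

open Polynomial

/-- Chain version of `exists_symplectic_jordan`, with chains numbered by `Fin t`. -/
theorem exists_symplectic_chains {K V : Type*} [Field K] [CharZero K] [IsAlgClosed K]
    [AddCommGroup V] [Module K V] [FiniteDimensional K V] {b : LinearMap.BilinForm K V}
    {B : Module.End K V} (hb : b.IsAlt) (hnd : b.Nondegenerate)
    (hB : ∀ x y, b (B x) y = b x (B y)) (P : K → Prop) {l₀ : K} (h₀ : P l₀)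
    (hP : ∀ l, B.HasEigenvalue l → P l) :
    ∃ (t : ℕ) (_ : 0 < t) (k : Fin t → ℕ) (l : Fin t → K) (u v : Fin t → ℕ → V),
      (∀ j, P (l j)) ∧
      (∀ j s, B (u j s) = l j • u j s + u j (s + 1)) ∧
      (∀ j s, B (v j s) = l j • v j s + v j (s + 1)) ∧
      (∀ j, u j (k j) = 0) ∧ (∀ j, v j (k j) = 0) ∧
      (∀ i j s r, b (u i s) (u j r) = 0) ∧ (∀ i j s r, b (v i s) (v j r) = 0) ∧
      (∀ i j s r, b (u i s) (v j r) = if i = j ∧ s + r + 1 = k j then 1 else 0) ∧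
      ∑ j, 2 * k j = Module.finrank K V := by
  obtain ⟨ι, _, _, k, l, x, y, hl, hx, hy, hxx, hyy, hxy, hxy', hsum⟩ :=
    exists_symplectic_jordan P h₀ _ rfl hb hnd hB hP
  have hstep : ∀ (l : K) (s : ℕ) (z : V), B (aeval B ((X - C l) ^ s) z) =
      l • aeval B ((X - C l) ^ s) z + aeval B ((X - C l) ^ (s + 1)) z := by
    intro l s z
    rw [pow_succ' (X - C l), map_mul, Module.End.mul_apply]
    simp
  have hmul : ∀ (p q : K[X]) (z w : V), b (aeval B p z) (aeval B q w) =
      b z (aeval B (p * q) w) := by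
    intro p q z w
    rw [bilin_aeval_comm hB, map_mul, Module.End.mul_apply]
  let ε := (Fintype.equivFin ι).symm
  refine ⟨Fintype.card ι, Fintype.card_pos, k ∘ ε, l ∘ ε,
    fun j s => aeval B ((X - C (l (ε j))) ^ s) (x (ε j)),
    fun j s => aeval B ((X - C (l (ε j))) ^ s) (y (ε j)), fun j => hl _, fun j s => hstep _ _ _,
    fun j s => hstep _ _ _, fun j => hx _, fun j => hy _, fun i j s r => ?_, fun i j s r => ?_,
    fun i j s r => ?_, ?_⟩
  · rw [hmul, hxx]
  · rw [hmul, hyy]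
  · rw [hmul]
    by_cases hij : i = j
    · subst hij
      rw [← pow_add, hxy']
      simp
    · rw [hxy _ _ _ (fun h => hij (ε.injective h)), if_neg (fun h => hij h.1)]
  · rw [← hsum]
    exact Equiv.sum_comp ε fun i => 2 * k i

end SymplecticChains

section ChainMatrix

variable {C Y : Type*} [Fintype C] [DecidableEq C] [Fintype Y] {K : C → ℕ}

/-- The matrix whose columns are the vectors of the chains `w c`, in reverse order. -/
def chainMatrix (K : C → ℕ) (w : C → ℕ → Y → ℂ) : Matrix Y (Σ c, Fin (K c)) ℂ :=
  Matrix.of fun i x => w x.1 (K x.1 - 1 - x.2) i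

theorem mul_chainMatrix {L : C → ℂ} {w : C → ℕ → Y → ℂ} {B : Matrix Y Y ℂ}
    (hB : ∀ c s, B *ᵥ w c s = L c • w c s + w c (s + 1)) (hK : ∀ c, w c (K c) = 0) :
    B * chainMatrix K w = chainMatrix K w * jordanSum K L := by
  ext i ⟨c, q⟩
  have h1 : (B * chainMatrix K w) i ⟨c, q⟩ = (B *ᵥ w c (K c - 1 - q)) i := rfl
  rw [h1, hB, Matrix.mul_apply, Fintype.sum_sigma, Fintype.sum_eq_single c]
  · have hsplit : ∀ p : Fin (K c), chainMatrix K w i ⟨c, p⟩ * jordanSum K L ⟨c, p⟩ ⟨c, q⟩ =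
        (if p = q then L c * w c (K c - 1 - p) i else 0) +
          if (p : ℕ) + 1 = q then w c (K c - 1 - p) i else 0 := by
      intro p
      by_cases h : p = q
      · simp [chainMatrix, jordanSum, h, mul_comm]
      · have h' : (p : ℕ) ≠ q := fun h'' => h (Fin.ext h'')
        simp [chainMatrix, jordanSum, h, h']
    simp only [hsplit, Finset.sum_add_distrib, Finset.sum_ite_eq', Finset.mem_univ, if_true,
      Pi.add_apply, Pi.smul_apply, smul_eq_mul]
    congr 1
    obtain ⟨q, hq⟩ := q
    rcases q with _ | q
    · have : K c - 1 + 1 = K c := by omega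
      simp [this, hK]
    · rw [Finset.sum_eq_single ⟨q, by omega⟩]
      · have : K c - 1 - (q + 1) + 1 = K c - 1 - q := by omega
        simp [this]
      · intro p _ hp
        have : (p : ℕ) ≠ q := fun h => hp (Fin.ext h)
        simp [this]
      · simp
  · intro d hd
    refine Finset.sum_eq_zero fun p _ => ?_
    simp [jordanSum, hd]

theorem chainMatrix_gram {C : Type*} [DecidableEq C] {K : C → ℕ} {sgn : C → Bool}
    {w : C → ℕ → Y → ℂ} {H : Matrix Y Y ℂ}
    (hH : ∀ c s d r, star (w c s) ⬝ᵥ (H *ᵥ w d r) =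
      if c = d ∧ s + r + 1 = K c then boolSign (sgn c) else 0) :
    (chainMatrix K w)ᴴ * H * chainMatrix K w = sipSum K sgn := by
  ext ⟨c, p⟩ ⟨d, q⟩
  have h1 : ((chainMatrix K w)ᴴ * H * chainMatrix K w) ⟨c, p⟩ ⟨d, q⟩ =
      star (w c (K c - 1 - p)) ⬝ᵥ (H *ᵥ w d (K d - 1 - q)) := by
    rw [Matrix.mul_assoc]
    rfl
  rw [h1, hH]
  simp only [sipSum, Matrix.of_apply]
  have hp := p.2
  have hq := q.2
  by_cases hcd : c = d
  · subst hcd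
    have : K c - 1 - p + (K c - 1 - q) + 1 = K c ↔ (p : ℕ) + q = K c - 1 := by omega
    simp [this]
  · simp [hcd]

theorem sipSum_mul_self (sgn : C → Bool) : sipSum K sgn * sipSum K sgn = 1 := by
  let rev : (Σ c, Fin (K c)) → Σ c, Fin (K c) := fun x => ⟨x.1, Fin.rev x.2⟩
  have hrev : ∀ x, rev (rev x) = x := fun x => by simp [rev]
  have hsip : ∀ x z, sipSum K sgn x z = if z = rev x then boolSign (sgn x.1) else 0 := by
    rintro ⟨c, p⟩ ⟨d, q⟩
    simp only [sipSum, Matrix.of_apply]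
    congr 1
    apply propext
    constructor
    · rintro ⟨h1, h2⟩
      refine chain_ext h1.symm ?_
      simp only [rev, Fin.val_rev]
      omega
    · intro h
      obtain ⟨rfl, h2⟩ := Sigma.mk.inj_iff.mp h
      refine ⟨rfl, ?_⟩
      rw [eq_of_heq h2, Fin.val_rev]
      have := p.2
      dsimp only at this ⊢
      omega
  ext x y
  rw [Matrix.mul_apply]
  simp only [hsip, ite_mul, zero_mul, Finset.sum_ite_eq', Finset.mem_univ, if_true, hrev,
    Matrix.one_apply, eq_comm (a := y)]
  simp [rev, boolSign_mul_self]

end ChainMatrix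

section QuaternionicStructure

variable {n : ℕ}

theorem quatJ_conjTranspose (n : ℕ) : (quatJ n)ᴴ = -quatJ n := by
  rw [← quatJ_transpose]
  nth_rewrite 2 [← quatJ_map_conj]
  rfl

theorem InOmega.map_conj_mul {M : Matrix (Fin (2 * n)) (Fin (2 * n)) ℂ} (hM : InOmega M) :
    M.map (starRingEnd ℂ) * quatJ n = quatJ n * M := by
  have h := congrArg (fun N => N.map (starRingEnd ℂ)) (inOmega_iff.mp hM)
  have hM' : (M.map (starRingEnd ℂ)).map (starRingEnd ℂ) = M := by ext; simp
  simpa only [Matrix.map_mul, quatJ_map_conj, hM'] using h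

theorem InOmega.transpose_mul {M : Matrix (Fin (2 * n)) (Fin (2 * n)) ℂ} (hM : InOmega M) :
    Mᵀ * quatJ n = quatJ n * Mᴴ := by
  have h := congrArg Matrix.transpose hM.map_conj_mul
  rw [Matrix.transpose_mul, Matrix.transpose_mul, quatJ_transpose, mul_neg, neg_mul,
    neg_inj] at h
  exact h.symm

/-- The antilinear quaternionic structure on `ℂ^{2n}` commuting with `Ω_{2n}`. -/
def quatConj (v : Fin (2 * n) → ℂ) : Fin (2 * n) → ℂ := quatJ n *ᵥ star v

theorem star_quatConj (v : Fin (2 * n) → ℂ) : star (quatConj v) = quatJ n *ᵥ v := by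
  rw [quatConj, star_mulVec, star_star, quatJ_conjTranspose, ← quatJ_transpose,
    vecMul_transpose]

theorem quatConj_quatConj (v : Fin (2 * n) → ℂ) : quatConj (quatConj v) = -v := by
  rw [quatConj, star_quatConj, mulVec_mulVec, quatJ_mul_self, neg_mulVec, one_mulVec]

theorem quatConj_zero : quatConj (0 : Fin (2 * n) → ℂ) = 0 := by simp [quatConj]

theorem quatConj_add (v w : Fin (2 * n) → ℂ) : quatConj (v + w) = quatConj v + quatConj w := by
  simp [quatConj, mulVec_add]

theorem quatConj_smul (a : ℂ) (v : Fin (2 * n) → ℂ) :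
    quatConj (a • v) = star a • quatConj v := by
  simp [quatConj, mulVec_smul]

theorem InOmega.mulVec_quatConj {M : Matrix (Fin (2 * n)) (Fin (2 * n)) ℂ} (hM : InOmega M)
    (v : Fin (2 * n) → ℂ) : M *ᵥ quatConj v = quatConj (M *ᵥ v) := by
  rw [quatConj, quatConj, mulVec_mulVec, inOmega_iff.mp hM, ← mulVec_mulVec, star_mulVec]
  congr 1
  rw [← mulVec_transpose]
  rfl

variable {H B T : Matrix (Fin (2 * n)) (Fin (2 * n)) ℂ}

/-- The complex bilinear form attached to a Hermitian matrix and the quaternionic structure. -/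
def quatBilin (H : Matrix (Fin (2 * n)) (Fin (2 * n)) ℂ) :
    LinearMap.BilinForm ℂ (Fin (2 * n) → ℂ) :=
  Matrix.toBilin' (-(quatJ n * H))

theorem quatBilin_apply (v w : Fin (2 * n) → ℂ) :
    quatBilin H v w = star (quatConj v) ⬝ᵥ (H *ᵥ w) := by
  rw [quatBilin, toBilin'_apply', star_quatConj, ← vecMul_transpose (quatJ n), quatJ_transpose,
    ← dotProduct_mulVec, mulVec_mulVec, neg_mul]

theorem quatBilin_swap (hHΩ : InOmega H) (hH : H.IsHermitian) (v w : Fin (2 * n) → ℂ) :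
    quatBilin H v w = -quatBilin H w v := by
  have hG : (quatJ n * H)ᵀ = -(quatJ n * H) := by
    rw [Matrix.transpose_mul, quatJ_transpose, mul_neg, hHΩ.transpose_mul, hH.eq]
  simp only [quatBilin, toBilin'_apply', neg_mulVec, dotProduct_neg, neg_neg]
  rw [dotProduct_mulVec, ← mulVec_transpose, hG, neg_mulVec, neg_dotProduct, neg_neg,
    dotProduct_comm]

theorem quatBilin_selfAdjoint (hBΩ : InOmega B) (hB : H * B = Bᴴ * H) (v w : Fin (2 * n) → ℂ) :
    quatBilin H (B *ᵥ v) w = quatBilin H v (B *ᵥ w) := by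
  simp only [quatBilin, toBilin'_apply']
  rw [← vecMul_transpose, ← dotProduct_mulVec, mulVec_mulVec, mulVec_mulVec, mul_neg, neg_mul,
    ← mul_assoc, hBΩ.transpose_mul, mul_assoc, ← hB, mul_assoc]

theorem star_form_swap (hH : H.IsHermitian) (v w : Fin (2 * n) → ℂ) :
    star v ⬝ᵥ (H *ᵥ w) = star (star w ⬝ᵥ (H *ᵥ v)) := by
  rw [star_dotProduct, star_mulVec, hH.eq, dotProduct_mulVec]

theorem form_quatConj_quatConj (hHΩ : InOmega H) (hH : H.IsHermitian) (v w : Fin (2 * n) → ℂ) :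
    star (quatConj v) ⬝ᵥ (H *ᵥ quatConj w) = star (star v ⬝ᵥ (H *ᵥ w)) := by
  rw [← quatBilin_apply, quatBilin_swap hHΩ hH, quatBilin_apply, quatConj_quatConj, star_neg,
    neg_dotProduct, neg_neg, star_form_swap hH]

theorem finrank_eigenspace_I (hTΩ : InOmega T) (hT : T * T = -1) :
    Module.finrank ℂ (Module.End.eigenspace (toLin' T) Complex.I) = n := by
  have hTv : ∀ v, T *ᵥ (T *ᵥ v) = -v := fun v => by rw [mulVec_mulVec, hT, neg_mulVec, one_mulVec]
  have hproj : LinearMap.IsProj (Module.End.eigenspace (toLin' T) Complex.I)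
      (toLin' ((2 : ℂ)⁻¹ • (1 - Complex.I • T))) := by
    constructor
    · intro v
      rw [Module.End.mem_eigenspace_iff]
      simp only [toLin'_apply, smul_mulVec, sub_mulVec, one_mulVec, mulVec_smul, mulVec_sub, hTv]
      ext i
      simp
      linear_combination (1 / 2 : ℂ) * (T *ᵥ v) i * Complex.I_mul_I
    · intro v hv
      rw [Module.End.mem_eigenspace_iff, toLin'_apply] at hv
      simp only [toLin'_apply, smul_mulVec, sub_mulVec, one_mulVec, hv]
      ext i
      simp
      linear_combination (-1 / 2 : ℂ) * v i * Complex.I_mul_I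
  have htr := hproj.trace
  have hreal : (T.trace).im = 0 := by
    have h : T = -(quatJ n * T.map (starRingEnd ℂ) * quatJ n) := by
      rw [← inOmega_iff.mp hTΩ, mul_assoc, quatJ_mul_self]; simp
    have h2 : T.trace = star T.trace := by
      nth_rewrite 1 [h]
      rw [trace_neg, Matrix.trace_mul_comm, ← mul_assoc, quatJ_mul_self]
      simp [Matrix.trace]
    have := congrArg Complex.im h2
    simp at this
    linarith
  rw [trace_toLin'_eq] at htr
  have := congrArg Complex.re htr
  simp [hreal] at this
  exact_mod_cast this.symm

end QuaternionicStructure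

section QuaternionicChains

variable {n : ℕ} {H B T : Matrix (Fin (2 * n)) (Fin (2 * n)) ℂ}

theorem form_eq_zero_of_eigenvectors (hTsa : H * T = Tᴴ * H) {v w : Fin (2 * n) → ℂ}
    (hv : T *ᵥ v = Complex.I • v) (hw : T *ᵥ w = Complex.I • w) : star v ⬝ᵥ (H *ᵥ w) = 0 := by
  have h1 : star v ⬝ᵥ (H *ᵥ (T *ᵥ w)) = star (T *ᵥ v) ⬝ᵥ (H *ᵥ w) := by
    rw [mulVec_mulVec, hTsa, ← mulVec_mulVec, dotProduct_mulVec (star v), star_mulVec]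
  rw [hv, hw, mulVec_smul, dotProduct_smul, star_smul, smul_dotProduct] at h1
  simp only [smul_eq_mul, Complex.star_def, Complex.conj_I] at h1
  have h2 : (2 * Complex.I) * (star v ⬝ᵥ (H *ᵥ w)) = 0 := by linear_combination h1
  exact (mul_eq_zero.mp h2).resolve_left (by simp)

theorem eq_zero_of_quatBilin_eq_zero (hHu : IsUnit H) {v : Fin (2 * n) → ℂ}
    (hv : ∀ w, quatBilin H v w = 0) : v = 0 := by
  have h1 : (quatJ n *ᵥ v) ᵥ* H = 0 := by
    refine dotProduct_eq_zero _ fun w => ?_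
    rw [← dotProduct_mulVec, ← star_quatConj, ← quatBilin_apply, hv]
  have h2 := Matrix.vecMul_injective_of_isUnit hHu (h1.trans (zero_vecMul H).symm)
  have h3 := congrArg (fun x => quatJ n *ᵥ x) h2
  simpa only [mulVec_mulVec, quatJ_mul_self, mulVec_zero, neg_mulVec, one_mulVec,
    neg_eq_zero] using h3

theorem quatBilin_separating_eigenspace (hHu : IsUnit H) (hTΩ : InOmega T)
    (hTsa : H * T = Tᴴ * H) (hT : T * T = -1) {v : Fin (2 * n) → ℂ}
    (hv : T *ᵥ v = Complex.I • v)
    (h : ∀ w, T *ᵥ w = Complex.I • w → quatBilin H v w = 0) : v = 0 := by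
  refine eq_zero_of_quatBilin_eq_zero hHu fun w => ?_
  have h1 := h (w - Complex.I • (T *ᵥ w)) (by
    rw [mulVec_sub, mulVec_smul, mulVec_mulVec, hT, neg_mulVec, one_mulVec, smul_sub,
      smul_smul, Complex.I_mul_I]
    module)
  have h2 := quatBilin_selfAdjoint hTΩ hTsa v w
  rw [hv, map_smul, LinearMap.smul_apply, smul_eq_mul] at h2
  rw [map_sub, map_smul, ← h2, smul_eq_mul] at h1
  linear_combination (1 / 2 : ℂ) * h1 + (1 / 2 : ℂ) * quatBilin H v w * Complex.I_mul_I

theorem exists_quaternionic_chains (hHΩ : InOmega H) (hHu : IsUnit H) (hH : H.IsHermitian)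
    (hBΩ : InOmega B) (hB : H * B = Bᴴ * H) (hspec : ∀ μ ∈ spectrum ℂ B, μ.im = 0 ∧ μ.re < 0)
    (hTΩ : InOmega T) (hTsa : H * T = Tᴴ * H) (hTB : Commute T B) (hT : T * T = -1) :
    ∃ (t : ℕ) (_ : 0 < t) (k : Fin t → ℕ) (l : Fin t → ℝ) (u v : Fin t → ℕ → Fin (2 * n) → ℂ),
      (∀ j, l j < 0) ∧
      (∀ j s, B *ᵥ u j s = (l j : ℂ) • u j s + u j (s + 1)) ∧
      (∀ j s, B *ᵥ v j s = (l j : ℂ) • v j s + v j (s + 1)) ∧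
      (∀ j, u j (k j) = 0) ∧ (∀ j, v j (k j) = 0) ∧
      (∀ i j s r, quatBilin H (u i s) (u j r) = 0) ∧
      (∀ i j s r, quatBilin H (v i s) (v j r) = 0) ∧
      (∀ i j s r, quatBilin H (u i s) (v j r) = if i = j ∧ s + r + 1 = k j then 1 else 0) ∧
      (∀ i j s r, star (u i s) ⬝ᵥ (H *ᵥ u j r) = 0) ∧
      (∀ i j s r, star (v i s) ⬝ᵥ (H *ᵥ v j r) = 0) ∧
      (∀ i j s r, star (u i s) ⬝ᵥ (H *ᵥ v j r) = 0) ∧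
      ∑ j, 2 * k j = n := by
  obtain ⟨W, hW⟩ : ∃ W, W = Module.End.eigenspace (toLin' T) Complex.I := ⟨_, rfl⟩
  have hmem : ∀ v, v ∈ W ↔ T *ᵥ v = Complex.I • v := fun v => by
    rw [hW, Module.End.mem_eigenspace_iff, toLin'_apply]
  have hBW : ∀ v ∈ W, toLin' B v ∈ W := by
    intro v hv
    rw [hmem] at hv ⊢
    rw [toLin'_apply, mulVec_mulVec, hTB.eq, ← mulVec_mulVec, hv, mulVec_smul]
  have hiso : ∀ v w : W, star (v : Fin (2 * n) → ℂ) ⬝ᵥ (H *ᵥ w) = 0 := fun v w =>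
    form_eq_zero_of_eigenvectors hTsa ((hmem v).mp v.2) ((hmem w).mp w.2)
  obtain ⟨b, hb⟩ : ∃ b : LinearMap.BilinForm ℂ W, ∀ v w : W, b v w = quatBilin H v w :=
    ⟨(quatBilin H).restrict W, fun _ _ => rfl⟩
  obtain ⟨β, hβ⟩ : ∃ β : Module.End ℂ W, ∀ v : W, (β v : Fin (2 * n) → ℂ) = B *ᵥ v :=
    ⟨(toLin' B).restrict hBW, fun _ => rfl⟩
  have halt : b.IsAlt := fun v => by
    rw [hb]; exact self_eq_neg.mp (quatBilin_swap hHΩ hH _ _)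
  have hnd : b.Nondegenerate := by
    refine halt.isRefl.nondegenerate_iff_separatingLeft.mpr fun v hv => Subtype.ext ?_
    exact quatBilin_separating_eigenspace hHu hTΩ hTsa hT ((hmem v).mp v.2) fun w hw =>
      (hb v ⟨w, (hmem w).mpr hw⟩).symm.trans (hv _)
  have hβsa : ∀ v w, b (β v) w = b v (β w) := fun v w => by
    rw [hb, hb, hβ, hβ, quatBilin_selfAdjoint hBΩ hB]
  have heig : ∀ l, β.HasEigenvalue l → l.im = 0 ∧ l.re < 0 := by
    intro l hl
    obtain ⟨v, hv⟩ := hl.exists_hasEigenvector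
    refine hspec l ?_
    rw [← Matrix.spectrum_toLin', ← Module.End.hasEigenvalue_iff_mem_spectrum]
    refine Module.End.hasEigenvalue_of_hasEigenvector (x := (v : Fin (2 * n) → ℂ)) ⟨?_, ?_⟩
    · rw [Module.End.mem_eigenspace_iff, toLin'_apply, ← hβ, hv.apply_eq_smul]
      rfl
    · simpa using hv.2
  obtain ⟨t, ht, k, l, u, v, hl, hu, hv, hu0, hv0, huu, hvv, huv, hsum⟩ :=
    exists_symplectic_chains halt hnd hβsa (fun l : ℂ => l.im = 0 ∧ l.re < 0) (l₀ := -1)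
      (by simp) heig
  simp only [hb] at huu hvv huv
  have hre : ∀ j, ((l j).re : ℂ) = l j := fun j => Complex.ext rfl (by simp [(hl j).1])
  rw [hW, finrank_eigenspace_I hTΩ hT] at hsum
  refine ⟨t, ht, k, fun j => (l j).re, fun j s => u j s, fun j s => v j s, fun j => (hl j).2,
    fun j s => ?_, fun j s => ?_, fun j => by simp [hu0], fun j => by simp [hv0],
    huu, hvv, huv, fun i j s r => hiso _ _, fun i j s r => hiso _ _, fun i j s r => hiso _ _,
    hsum⟩
  · rw [hre, ← hβ, hu]; rfl
  · rw [hre, ← hβ, hv]; rfl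

/-- The vectors `(u ∓ J v) / √2`, whose chains are orthogonal and of sign `±1`. -/
def signedChain {t : ℕ} (u v : Fin t → ℕ → Fin (2 * n) → ℂ) (j : Fin t) (b : Bool) (s : ℕ) :
    Fin (2 * n) → ℂ :=
  ((√2 : ℝ) : ℂ)⁻¹ • (u j s - boolSign b • quatConj (v j s))

/-- The chains of `signedChain` followed by their images under the quaternionic structure. -/
def doubledChain {t : ℕ} (u v : Fin t → ℕ → Fin (2 * n) → ℂ) (c : (Fin t ⊕ Fin t) × Bool)
    (s : ℕ) : Fin (2 * n) → ℂ :=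
  Sum.elim (fun j => signedChain u v j c.2 s) (fun j => quatConj (signedChain u v j c.2 s)) c.1

variable {t : ℕ} {k : Fin t → ℕ} {u v : Fin t → ℕ → Fin (2 * n) → ℂ}

theorem mulVec_doubledChain (hBΩ : InOmega B) {l : Fin t → ℝ}
    (hu : ∀ j s, B *ᵥ u j s = (l j : ℂ) • u j s + u j (s + 1))
    (hv : ∀ j s, B *ᵥ v j s = (l j : ℂ) • v j s + v j (s + 1))
    (c : (Fin t ⊕ Fin t) × Bool) (s : ℕ) :
    B *ᵥ doubledChain u v c s =
      (l (Sum.elim id id c.1) : ℂ) • doubledChain u v c s + doubledChain u v c (s + 1) := by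
  have h : ∀ j b, B *ᵥ signedChain u v j b s =
      (l j : ℂ) • signedChain u v j b s + signedChain u v j b (s + 1) := by
    intro j b
    simp only [signedChain, mulVec_smul, mulVec_sub, hBΩ.mulVec_quatConj, hu, hv, quatConj_add,
      quatConj_smul, Complex.star_def, Complex.conj_ofReal]
    module
  rcases c with ⟨j | j, b⟩
  · exact h j b
  · simp only [doubledChain, Sum.elim_inr, hBΩ.mulVec_quatConj, h, quatConj_add, quatConj_smul,
      Complex.star_def, Complex.conj_ofReal]
    rfl

theorem doubledChain_eq_zero (hu0 : ∀ j, u j (k j) = 0) (hv0 : ∀ j, v j (k j) = 0)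
    (c : (Fin t ⊕ Fin t) × Bool) : doubledChain u v c (k (Sum.elim id id c.1)) = 0 := by
  rcases c with ⟨j | j, b⟩ <;> simp [doubledChain, signedChain, hu0, hv0, quatConj_zero]

theorem doubledChain_gram (hHΩ : InOmega H) (hH : H.IsHermitian)
    (huu : ∀ i j s r, quatBilin H (u i s) (u j r) = 0)
    (hvv : ∀ i j s r, quatBilin H (v i s) (v j r) = 0)
    (huv : ∀ i j s r, quatBilin H (u i s) (v j r) = if i = j ∧ s + r + 1 = k j then 1 else 0)
    (huu' : ∀ i j s r, star (u i s) ⬝ᵥ (H *ᵥ u j r) = 0)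
    (hvv' : ∀ i j s r, star (v i s) ⬝ᵥ (H *ᵥ v j r) = 0)
    (huv' : ∀ i j s r, star (u i s) ⬝ᵥ (H *ᵥ v j r) = 0)
    (c : (Fin t ⊕ Fin t) × Bool) (s : ℕ) (d : (Fin t ⊕ Fin t) × Bool) (r : ℕ) :
    star (doubledChain u v c s) ⬝ᵥ (H *ᵥ doubledChain u v d r) =
      if c = d ∧ s + r + 1 = k (Sum.elim id id c.1) then boolSign c.2 else 0 := by
  have hJl : ∀ x y, star (quatConj x) ⬝ᵥ (H *ᵥ y) = quatBilin H x y := fun x y =>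
    (quatBilin_apply x y).symm
  have hJr : ∀ x y, star x ⬝ᵥ (H *ᵥ quatConj y) = star (quatBilin H y x) := fun x y => by
    rw [star_form_swap hH, hJl]
  have hvu' : ∀ i j s r, star (v i s) ⬝ᵥ (H *ᵥ u j r) = 0 := fun i j s r => by
    rw [star_form_swap hH, huv', star_zero]
  have hvu : ∀ i j s r, quatBilin H (v i s) (u j r) =
      -if i = j ∧ s + r + 1 = k j then 1 else 0 := by
    intro i j s r
    rw [quatBilin_swap hHΩ hH, huv]
    congr 1
    by_cases hij : i = j
    · subst hij; simp [add_comm s r]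
    · simp [hij, Ne.symm hij]
  have hsqrt : ((√2 : ℝ) : ℂ)⁻¹ * ((√2 : ℝ) : ℂ)⁻¹ = 1 / 2 := by
    rw [← mul_inv, ← Complex.ofReal_mul, Real.mul_self_sqrt (by norm_num)]
    norm_num
  have hgg : ∀ i b s j d r, star (signedChain u v i b s) ⬝ᵥ (H *ᵥ signedChain u v j d r) =
      if (i = j ∧ b = d) ∧ s + r + 1 = k i then boolSign b else 0 := by
    intro i b s j d r
    simp only [signedChain, mulVec_smul, mulVec_sub, dotProduct_smul, dotProduct_sub, star_smul,
      star_sub, smul_dotProduct, sub_dotProduct, form_quatConj_quatConj hHΩ hH, hJl, hJr, huu',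
      hvv', hvu, star_boolSign]
    have hflip : (j = i ∧ r + s + 1 = k i) ↔ (i = j ∧ s + r + 1 = k j) := by
      constructor <;> rintro ⟨rfl, h⟩ <;> exact ⟨rfl, by omega⟩
    have hconj : star (((√2 : ℝ) : ℂ)⁻¹) = ((√2 : ℝ) : ℂ)⁻¹ := by
      rw [star_inv₀, Complex.star_def, Complex.conj_ofReal]
    have hcond : ((i = j ∧ b = d) ∧ s + r + 1 = k i) ↔ (i = j ∧ s + r + 1 = k j) ∧ b = d := by
      constructor
      · rintro ⟨⟨rfl, h⟩, h'⟩; exact ⟨⟨rfl, h'⟩, h⟩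
      · rintro ⟨⟨rfl, h⟩, h'⟩; exact ⟨⟨rfl, h'⟩, h⟩
    simp only [hconj, smul_eq_mul, hflip, hcond]
    by_cases h : i = j ∧ s + r + 1 = k j
    · simp only [h, if_true, true_and, and_self]
      cases b <;> cases d <;> simp [boolSign]
      · linear_combination 2 * hsqrt
      · linear_combination -2 * hsqrt
    · simp [h]
  have hgJ : ∀ i b s j d r, star (signedChain u v i b s) ⬝ᵥ
      (H *ᵥ quatConj (signedChain u v j d r)) = 0 := by
    intro i b s j d r
    rw [hJr]
    simp only [signedChain, map_smul, map_sub, LinearMap.smul_apply, LinearMap.sub_apply]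
    have h1 : ∀ i j s r, quatBilin H (u i s) (quatConj (v j r)) = 0 := fun i j s r => by
      rw [quatBilin_apply, form_quatConj_quatConj hHΩ hH, huv', star_zero]
    have h2 : ∀ i j s r, quatBilin H (quatConj (v i s)) (u j r) = 0 := fun i j s r => by
      rw [quatBilin_swap hHΩ hH, h1, neg_zero]
    have h3 : ∀ i j s r, quatBilin H (quatConj (v i s)) (quatConj (v j r)) = 0 := fun i j s r => by
      rw [quatBilin_apply, form_quatConj_quatConj hHΩ hH, hJl, hvv, star_zero]
    simp [huu, h1, h2, h3]
  rcases c with ⟨i | i, b⟩ <;> rcases d with ⟨j | j, d⟩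
  · simp [doubledChain, hgg]
  · simp [doubledChain, hgJ]
  · rw [star_form_swap hH]
    simp [doubledChain, hgJ]
  · simp only [doubledChain, Sum.elim_inr, form_quatConj_quatConj hHΩ hH, hgg, apply_ite star,
      star_boolSign, star_zero, Prod.mk.injEq, Sum.inr.injEq, id]

end QuaternionicChains

section QuaternionicCanonicalForm

variable {n : ℕ}

theorem quatConj_apply_inl (v : Fin (2 * n) → ℂ) (a : Fin n) :
    quatConj v (finTwoMul n (Sum.inl a)) = -star (v (finTwoMul n (Sum.inr a))) := by
  rw [quatConj, quatJ, reindex_apply, submatrix_mulVec_equiv]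
  simp [fromBlocks_mulVec, neg_mulVec, Function.comp_def]

theorem quatConj_apply_inr (v : Fin (2 * n) → ℂ) (a : Fin n) :
    quatConj v (finTwoMul n (Sum.inr a)) = star (v (finTwoMul n (Sum.inl a))) := by
  rw [quatConj, quatJ, reindex_apply, submatrix_mulVec_equiv]
  simp [fromBlocks_mulVec, Function.comp_def]

/-- A matrix lies in `Ω` once its right columns are the images of its left columns under the
quaternionic structure. -/
theorem inOmega_of_col_quatConj {S : Matrix (Fin (2 * n)) (Fin (2 * n)) ℂ}
    (hS : ∀ a : Fin n, S.col (finTwoMul n (Sum.inr a)) =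
      quatConj (S.col (finTwoMul n (Sum.inl a)))) :
    InOmega S := by
  have h1 : ∀ a b : Fin n, S (finTwoMul n (Sum.inl a)) (finTwoMul n (Sum.inr b)) =
      -star (S (finTwoMul n (Sum.inr a)) (finTwoMul n (Sum.inl b))) := fun a b => by
    exact (congrFun (hS b) _).trans (quatConj_apply_inl _ a)
  have h2 : ∀ a b : Fin n, S (finTwoMul n (Sum.inr a)) (finTwoMul n (Sum.inr b)) =
      star (S (finTwoMul n (Sum.inl a)) (finTwoMul n (Sum.inl b))) := fun a b => by
    exact (congrFun (hS b) _).trans (quatConj_apply_inr _ a)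
  refine ⟨Matrix.of fun i j => S (finTwoMul n (Sum.inl i)) (finTwoMul n (Sum.inl j)),
    Matrix.of fun i j => -S (finTwoMul n (Sum.inr i)) (finTwoMul n (Sum.inl j)), ?_⟩
  ext i j
  obtain ⟨i, rfl⟩ := (finTwoMul n).surjective i
  obtain ⟨j, rfl⟩ := (finTwoMul n).surjective j
  rcases i with i | i <;> rcases j with j | j <;> simp [omegaMap, h1, h2]

/-- Positions in a doubled family of chains: the first copy, then the second copy. -/
def doubledIndexEquiv {t : ℕ} (k : Fin t → ℕ) :
    (Σ c : (Fin t ⊕ Fin t) × Bool, Fin (k (Sum.elim id id c.1))) ≃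
      (Σ c : Fin t × Bool, Fin (k c.1)) ⊕ Σ c : Fin t × Bool, Fin (k c.1) where
  toFun
    | ⟨(Sum.inl j, b), p⟩ => Sum.inl ⟨(j, b), p⟩
    | ⟨(Sum.inr j, b), p⟩ => Sum.inr ⟨(j, b), p⟩
  invFun
    | Sum.inl ⟨(j, b), p⟩ => ⟨(Sum.inl j, b), p⟩
    | Sum.inr ⟨(j, b), p⟩ => ⟨(Sum.inr j, b), p⟩
  left_inv := by rintro ⟨⟨j | j, b⟩, p⟩ <;> rfl
  right_inv := by rintro (⟨⟨j, b⟩, p⟩ | ⟨⟨j, b⟩, p⟩) <;> rfl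

theorem exists_similar_of_complex_structure {H B T : Matrix (Fin (2 * n)) (Fin (2 * n)) ℂ}
    (hHΩ : InOmega H) (hHu : IsUnit H) (hH : H.IsHermitian)
    (hBΩ : InOmega B) (hB : H * B = Bᴴ * H) (hspec : ∀ μ ∈ spectrum ℂ B, μ.im = 0 ∧ μ.re < 0)
    (hTΩ : InOmega T) (hTsa : H * T = Tᴴ * H) (hTB : Commute T B) (hT : T * T = -1) :
    ∃ (t : ℕ) (_ : 0 < t) (k : Fin t → ℕ) (l : Fin t → ℝ)
      (e : (Σ c : (Fin t ⊕ Fin t) × Bool, Fin (k (Sum.elim id id c.1))) ≃ Fin (2 * n))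
      (S : Matrix (Fin (2 * n)) (Fin (2 * n)) ℂ),
      (∀ j, l j < 0) ∧ IsUnit S ∧ InOmega S ∧
      S⁻¹ * B * S = reindex e e (jordanSum
        (fun c : (Fin t ⊕ Fin t) × Bool => k (Sum.elim id id c.1))
        fun c => (l (Sum.elim id id c.1) : ℂ)) ∧
      Sᴴ * H * S = reindex e e (sipSum
        (fun c : (Fin t ⊕ Fin t) × Bool => k (Sum.elim id id c.1)) fun c => c.2) := by
  obtain ⟨t, ht, k, l, u, v, hl, hu, hv, hu0, hv0, huu, hvv, huv, huu', hvv', huv', hsum⟩ :=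
    exists_quaternionic_chains hHΩ hHu hH hBΩ hB hspec hTΩ hTsa hTB hT
  have hcard : Fintype.card (Σ c : Fin t × Bool, Fin (k c.1)) = n := by
    rw [Fintype.card_sigma, Fintype.sum_prod_type, ← hsum]
    simp [two_mul]
  let ε := Fintype.equivFinOfCardEq hcard
  let e := (doubledIndexEquiv k).trans ((Equiv.sumCongr ε ε).trans (finTwoMul n))
  let K : (Fin t ⊕ Fin t) × Bool → ℕ := fun c => k (Sum.elim id id c.1)
  let R := chainMatrix K (doubledChain u v)
  have hRB := mul_chainMatrix (K := K) (mulVec_doubledChain hBΩ hu hv)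
    (doubledChain_eq_zero hu0 hv0)
  have hRH := chainMatrix_gram (K := K) (sgn := fun c => c.2)
    (doubledChain_gram hHΩ hH huu hvv huv huu' hvv' huv')
  let S := R.submatrix id e.symm
  have hSΩ : InOmega S := by
    refine inOmega_of_col_quatConj fun a => ?_
    obtain ⟨⟨⟨j, b⟩, p⟩, rfl⟩ := ε.surjective a
    have h1 : e.symm (finTwoMul n (Sum.inl (ε ⟨(j, b), p⟩))) = ⟨(Sum.inl j, b), p⟩ := by
      rw [Equiv.symm_apply_eq]; rfl
    have h2 : e.symm (finTwoMul n (Sum.inr (ε ⟨(j, b), p⟩))) = ⟨(Sum.inr j, b), p⟩ := by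
      rw [Equiv.symm_apply_eq]; rfl
    have h3 : ∀ y, S.col y = R.col (e.symm y) := fun y => rfl
    rw [h3, h3, h1, h2]
    rfl
  have hSH : Sᴴ * H * S = reindex e e (sipSum K fun c => c.2) := by
    rw [← hRH]
    rfl
  have hSB : B * S = S * reindex e e (jordanSum K fun c => (l (Sum.elim id id c.1) : ℂ)) := by
    rw [reindex_apply, submatrix_mul_equiv, ← hRB]
    rfl
  have hSu : IsUnit S := by
    refine IsUnit.of_mul_eq_one_right (reindex e e (sipSum K fun c => c.2) * (Sᴴ * H)) ?_
    rw [Matrix.mul_assoc, hSH]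
    simp [sipSum_mul_self]
  refine ⟨t, ht, k, l, e, S, hl, hSu, hSΩ, ?_, hSH⟩
  rw [Matrix.mul_assoc, hSB, ← Matrix.mul_assoc,
    Matrix.nonsing_inv_mul _ ((Matrix.isUnit_iff_isUnit_det S).mp hSu), Matrix.one_mul]

end QuaternionicCanonicalForm

/-- **Theorem 3.6.** For `m` even, an `H̃`-selfadjoint matrix `B̃ ∈ Ω_{4n}` with only
negative real eigenvalues has an `H̃`-selfadjoint `m`th root in `Ω_{4n}` iff the canonical
form of `(B̃, H̃)` consists of pairs `J_{k_j}(λ_j) ⊕ J_{k_j}(λ_j)` with sign pairs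
`Q_{k_j} ⊕ −Q_{k_j}`, the whole repeated twice. -/
theorem exists_root_negative_spectrum_even {n : ℕ} (m : ℕ) (hm : 0 < m) (heven : Even m)
    (H B : Matrix (Fin (2 * (2 * n))) (Fin (2 * (2 * n))) ℂ)
    (hHΩ : InOmega H) (hHu : IsUnit H) (hHherm : H.IsHermitian)
    (hBΩ : InOmega B) (hBsa : H * B = Bᴴ * H)
    (hspec : ∀ μ ∈ spectrum ℂ B, μ.im = 0 ∧ μ.re < 0) :
    (∃ A : Matrix (Fin (2 * (2 * n))) (Fin (2 * (2 * n))) ℂ,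
        InOmega A ∧ H * A = Aᴴ * H ∧ A ^ m = B) ↔
    ∃ (t : ℕ) (_ : 0 < t) (k : Fin t → ℕ) (lam : Fin t → ℝ)
      (e : ((i : Fin t ⊕ Fin t) × Fin (2 * k (Sum.elim id id i))) ≃ Fin (2 * (2 * n)))
      (S : Matrix (Fin (2 * (2 * n))) (Fin (2 * (2 * n))) ℂ),
      (∀ j, lam j < 0) ∧ IsUnit S ∧ InOmega S ∧
      S⁻¹ * B * S = Matrix.reindex e e (Matrix.blockDiagonal'
        (fun i : Fin t ⊕ Fin t =>
          dsum2 (jordanBlock ((lam (Sum.elim id id i) : ℂ)) (k (Sum.elim id id i)))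
            (jordanBlock ((lam (Sum.elim id id i) : ℂ)) (k (Sum.elim id id i))))) ∧
      Sᴴ * H * S = Matrix.reindex e e (Matrix.blockDiagonal'
        (fun i : Fin t ⊕ Fin t =>
          dsum2 (sip ℂ (k (Sum.elim id id i))) (-sip ℂ (k (Sum.elim id id i))))) := by
  constructor
  · rintro ⟨A, hAΩ, hAsa, hAB⟩
    obtain ⟨T, hTΩ, hTsa, hTB, hT⟩ :=
      exists_complex_structure_of_root heven hBΩ hBsa hspec hAΩ hAsa hAB
    obtain ⟨t, ht, k, lam, e, S, hlam, hSu, hSΩ, hSB, hSH⟩ :=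
      exists_similar_of_complex_structure hHΩ hHu hHherm hBΩ hBsa hspec hTΩ hTsa hTB hT
    let k' : Fin t ⊕ Fin t → ℕ := fun i => k (Sum.elim id id i)
    have he : (chainEquiv k').trans ((chainEquiv k').symm.trans e) = e := by
      ext; simp
    refine ⟨t, ht, k, lam, (chainEquiv k').symm.trans e, S, hlam, hSu, hSΩ, ?_, ?_⟩
    · rw [reindex_jordanBlocks (k := k') _ fun i => (lam (Sum.elim id id i) : ℂ), he]
      exact hSB
    · rw [reindex_sipBlocks (k := k'), he]
      exact hSH
  · rintro ⟨t, -, k, lam, e, S, -, hSu, hSΩ, hSB, hSH⟩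
    let k' : Fin t ⊕ Fin t → ℕ := fun i => k (Sum.elim id id i)
    rw [reindex_jordanBlocks (k := k') e fun i => (lam (Sum.elim id id i) : ℂ)] at hSB
    rw [reindex_sipBlocks (k := k') e] at hSH
    obtain ⟨T, hTΩ, hTsa, hTB, hT⟩ := exists_complex_structure_of_similar
      (L := fun i : Fin t ⊕ Fin t => lam (Sum.elim id id i)) hHΩ hBΩ hSΩ hSu _ hSB hSH
    exact exists_root_of_complex_structure hm hBΩ hBsa hspec hTΩ hTsa hTB hT

end
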